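/- Let α ∈ (0,1) and set δ_α = (1-α)·α^{α/(1-α)}. Then there exists a constant a > 0 such that for every z ∈ ℂ∖(-∞,0] the function t ↦ (1/(z+t) - 1/(1+t))·θ_α(t) is integrable on (0,∞) and G_α(z) = a·e^{-δ_α z}·exp(∫_0^∞ [1/(z+t) - 1/(1+t)]·θ_α(t) dt). -/

import Mathlib

open MeasureTheory Complex Set Filter

/-- The function `G_α` from Fourati's paper: for `z` in the slit plane,
`G_α(z) = (2πi)⁻¹ ∫_0^∞ (exp(-e^{-iπα} y^α z^{1-α}) - exp(-e^{iπα} y^α z^{1-α})) z⁻¹ e^{-y} dy`,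
all complex powers being principal branches. -/
noncomputable def Galpha (α : ℝ) (z : ℂ) : ℂ :=
  (2 * Real.pi * Complex.I)⁻¹ *
    ∫ y in Set.Ioi (0:ℝ),
      ((Complex.exp (-(Complex.exp (-(Real.pi * α : ℂ) * Complex.I)) * (y:ℂ) ^ (α:ℂ) * z ^ (1 - (α:ℂ))) -
        Complex.exp (-(Complex.exp ((Real.pi * α : ℂ) * Complex.I)) * (y:ℂ) ^ (α:ℂ) * z ^ (1 - (α:ℂ)))) / z) *
      Complex.exp (-(y:ℂ))

/-- The upper boundary value `G_α(-r^+)`. -/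
noncomputable def GalphaPlus (α r : ℝ) : ℂ :=
  (2 * Real.pi * Complex.I)⁻¹ *
    ∫ y in Set.Ioi (0:ℝ),
      ((Complex.exp ((r:ℂ) ^ (1 - (α:ℂ)) * (y:ℂ) ^ (α:ℂ)) -
        Complex.exp (Complex.exp (-(2 * Real.pi * α : ℂ) * Complex.I) * (r:ℂ) ^ (1 - (α:ℂ)) * (y:ℂ) ^ (α:ℂ))) / (r:ℂ)) *
      Complex.exp (-(y:ℂ))

/-- `θ_α(r) = -arg(G_α(-r^+))/π`. -/
noncomputable def thetaFun (α r : ℝ) : ℝ := -(GalphaPlus α r).arg / Real.pi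

/-- Zolotarev's integral formula for the density of the strictly `α`-stable
distribution with positivity parameter `ρ` (the integral is a real number; we take
the real part). -/
noncomputable def stableDensity (α ρ x : ℝ) : ℝ :=
  ((2 * Real.pi * Complex.I)⁻¹ *
    ∫ y in Set.Ioi (0:ℝ),
      ((Complex.exp (-(Complex.exp (-(Real.pi * ρ * α : ℂ) * Complex.I)) * (y:ℂ) ^ (α:ℂ) * (x:ℂ) ^ (-(α:ℂ))) -
        Complex.exp (-(Complex.exp ((Real.pi * ρ * α : ℂ) * Complex.I)) * (y:ℂ) ^ (α:ℂ) * (x:ℂ) ^ (-(α:ℂ)))) / (x:ℂ)) *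
      Complex.exp (-(y:ℂ))).re

/-- A function is completely monotone (on `(0,∞)`) if it is infinitely differentiable
there and `(-1)^n f^{(n)}(x) ≥ 0` for all `n` and `x > 0`. -/
def CompletelyMonotone (φ : ℝ → ℝ) : Prop :=
  ContDiffOn ℝ (⊤ : ℕ∞) φ (Set.Ioi 0) ∧
  ∀ (n : ℕ) (x : ℝ), 0 < x → 0 ≤ (-1 : ℝ) ^ n * iteratedDeriv n φ x

/-- A function `H` on `(0,∞)` is hyperbolically completely monotone if for every `u > 0`
the function `v ↦ H(uv)H(u/v)` is a completely monotone function of `v + 1/v`. -/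
def HCM (H : ℝ → ℝ) : Prop :=
  ∀ u : ℝ, 0 < u → ∃ φ : ℝ → ℝ, CompletelyMonotone φ ∧
    ∀ v : ℝ, 0 < v → H (u * v) * H (u / v) = φ (v + 1 / v)

open Metric Topology ComplexConjugate in
theorem hasDerivAt_integral_of_holomorphic {μ : Measure ℝ} {f : ℂ → ℝ → ℂ} {z₀ : ℂ} {r : ℝ}
    (hr : 0 < r) {bound : ℝ → ℝ}
    (hd : ∀ᵐ t ∂μ, DifferentiableOn ℂ (fun z => f z t) (ball z₀ r))
    (hm : ∀ z ∈ ball z₀ r, AEStronglyMeasurable (f z) μ)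
    (hb : ∀ᵐ t ∂μ, ∀ z ∈ ball z₀ r, ‖f z t‖ ≤ bound t) (hbi : Integrable bound μ) :
    Integrable (fun t => deriv (fun z => f z t) z₀) μ ∧
      HasDerivAt (fun z => ∫ t, f z t ∂μ) (∫ t, deriv (fun z => f z t) z₀ ∂μ) z₀ := by
  have hsub : ∀ x ∈ ball z₀ (r / 2), closedBall x (r / 3) ⊆ ball z₀ r := by
    intro x hx y hy
    rw [mem_ball] at *
    rw [mem_closedBall] at hy
    linarith [dist_triangle y x z₀]
  refine hasDerivAt_integral_of_dominated_loc_of_deriv_le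
    (F' := fun z t => deriv (fun z => f z t) z) (bound := fun t => bound t / (r / 3))
    (ball_mem_nhds z₀ (half_pos hr)) ?_ ?_ ?_ ?_ (hbi.div_const _) ?_
  · filter_upwards [ball_mem_nhds z₀ hr] with z hz using hm z hz
  · refine hbi.mono' (hm z₀ (mem_ball_self hr)) ?_
    filter_upwards [hb] with t ht using ht z₀ (mem_ball_self hr)
  · have hlim : Tendsto (fun n : ℕ => ((r / 2 / (n + 1) : ℝ) : ℂ)) atTop (𝓝[≠] 0) := by
      refine tendsto_nhdsWithin_iff.2 ⟨?_, ?_⟩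
      · have h := (tendsto_one_div_add_atTop_nhds_zero_nat (𝕜 := ℝ)).const_mul (r / 2)
        rw [mul_zero] at h
        have h2 := (Complex.continuous_ofReal.tendsto 0).comp h
        simpa [Function.comp_def, div_eq_mul_inv] using h2
      · refine Eventually.of_forall fun n => ?_
        have : (r / 2 / (n + 1) : ℝ) ≠ 0 := by positivity
        exact Complex.ofReal_ne_zero.2 this
    refine aestronglyMeasurable_of_tendsto_ae atTop
      (f := fun (n : ℕ) t => ((r / 2 / (n + 1) : ℝ) : ℂ)⁻¹ •
        (f (z₀ + ((r / 2 / (n + 1) : ℝ) : ℂ)) t - f z₀ t)) ?_ ?_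
    · intro n
      have hn : z₀ + ((r / 2 / (n + 1) : ℝ) : ℂ) ∈ ball z₀ r := ?_
      · exact ((hm _ hn).sub (hm _ (mem_ball_self hr))).const_smul (((r / 2 / (n + 1) : ℝ) : ℂ)⁻¹)
      rw [mem_ball, dist_eq, add_sub_cancel_left, Complex.norm_real, Real.norm_of_nonneg (by positivity)]
      have : r / 2 / (n + 1 : ℝ) ≤ r / 2 := div_le_self (by positivity) (by simp)
      linarith
    · filter_upwards [hd] with t ht
      have h1 := (ht.differentiableAt (ball_mem_nhds z₀ hr)).hasDerivAt
      exact (hasDerivAt_iff_tendsto_slope_zero.1 h1).comp hlim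
  · filter_upwards [hd, hb] with t ht hbt x hx
    refine Complex.norm_deriv_le_of_forall_mem_sphere_norm_le (by positivity) ?_ ?_
    · refine (ht.mono ?_).diffContOnCl
      rw [closure_ball _ (by positivity)]
      exact hsub x hx
    · intro z hz
      exact hbt z (hsub x hx (sphere_subset_closedBall hz))
  · filter_upwards [hd] with t ht x hx
    exact (ht.differentiableAt (isOpen_ball.mem_nhds
      (ball_subset_ball (by linarith) hx))).hasDerivAt

/-- The Laplace transform `∫₀^∞ exp (b y^α - a y) dy` of a stretched exponential. -/
noncomputable def stretchedLaplace (α : ℝ) (a b : ℂ) : ℂ :=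
  ∫ y in Ioi (0:ℝ), exp (b * ((y ^ α : ℝ) : ℂ) - a * y)

theorem rpow_mul_rpow_le_weighted {α y C : ℝ} (hα : α ∈ Ioo (0:ℝ) 1) (hy : 0 ≤ y) (hC : 0 ≤ C) :
    y ^ α * C ^ (1 - α) ≤ α * y + (1 - α) * C :=
  Real.geom_mean_le_arith_mean2_weighted hα.1.le (by linarith [hα.2]) hy hC (by ring)

theorem exp_stretched_le {α p q C y : ℝ} (hα : α ∈ Ioo (0:ℝ) 1) (hq : 0 < q) (hC : 0 ≤ C)
    (hp : p ≤ q * C ^ (1 - α)) (hy : 0 < y) :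
    Real.exp (p * y ^ α - q * y) ≤
      Real.exp (q * (1 - α) * C) * Real.exp (-(q * (1 - α)) * y) := by
  rw [← Real.exp_add, Real.exp_le_exp]
  have h1 := rpow_mul_rpow_le_weighted hα hy.le hC
  have h2 : p * y ^ α ≤ q * C ^ (1 - α) * y ^ α := by gcongr
  nlinarith

theorem continuousOn_stretched {α : ℝ} (a b : ℂ) :
    ContinuousOn (fun y : ℝ => exp (b * ((y ^ α : ℝ) : ℂ) - a * y)) (Ioi 0) := by
  have h : ContinuousOn (fun y : ℝ => ((y ^ α : ℝ) : ℂ)) (Ioi 0) :=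
    Complex.continuous_ofReal.comp_continuousOn
      (continuousOn_id.rpow_const fun x hx => Or.inl hx.ne')
  fun_prop

theorem aestronglyMeasurable_stretched {α : ℝ} (a b : ℂ) :
    AEStronglyMeasurable (fun y : ℝ => exp (b * ((y ^ α : ℝ) : ℂ) - a * y))
      (volume.restrict (Ioi 0)) :=
  (continuousOn_stretched a b).aestronglyMeasurable measurableSet_Ioi

theorem norm_stretched {α y : ℝ} (a b : ℂ) :
    ‖exp (b * ((y ^ α : ℝ) : ℂ) - a * y)‖ = Real.exp (b.re * y ^ α - a.re * y) := by
  rw [Complex.norm_exp, sub_re, re_mul_ofReal, re_mul_ofReal]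

theorem integrableOn_exp_stretched {α q : ℝ} (hα : α ∈ Ioo (0:ℝ) 1) (hq : 0 < q) (p : ℝ) :
    IntegrableOn (fun y : ℝ => Real.exp (p * y ^ α - q * y)) (Ioi 0) := by
  have hα1 : 0 < 1 - α := by linarith [hα.2]
  have hcont : ContinuousOn (fun y : ℝ => Real.exp (p * y ^ α - q * y)) (Ioi 0) := by
    have h : ContinuousOn (fun y : ℝ => y ^ α) (Ioi 0) :=
      continuousOn_id.rpow_const fun x hx => Or.inl hx.ne'
    fun_prop
  refine Integrable.mono' ((exp_neg_integrableOn_Ioi 0 (mul_pos hq hα1)).const_mul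
    (Real.exp (q * (1 - α) * (|p| / q) ^ (1 / (1 - α)))))
    (hcont.aestronglyMeasurable measurableSet_Ioi) ?_
  filter_upwards [ae_restrict_mem measurableSet_Ioi] with y hy
  rw [Real.norm_of_nonneg (Real.exp_pos _).le]
  refine exp_stretched_le hα hq (by positivity) ?_ hy
  rw [← Real.rpow_mul (by positivity), one_div_mul_cancel hα1.ne', Real.rpow_one,
    mul_div_cancel₀ _ hq.ne']
  exact le_abs_self p

theorem integral_exp_stretched_le {α p q C : ℝ} (hα : α ∈ Ioo (0:ℝ) 1) (hq : 0 < q) (hC : 0 ≤ C)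
    (hp : p ≤ q * C ^ (1 - α)) :
    ∫ y in Ioi (0:ℝ), Real.exp (p * y ^ α - q * y) ≤
      Real.exp (q * (1 - α) * C) / (q * (1 - α)) := by
  have hα1 : 0 < 1 - α := by linarith [hα.2]
  have hpos := mul_pos hq hα1
  calc _ ≤ ∫ y in Ioi (0:ℝ), Real.exp (q * (1 - α) * C) * Real.exp (-(q * (1 - α)) * y) :=
        setIntegral_mono_on (integrableOn_exp_stretched hα hq p)
          ((exp_neg_integrableOn_Ioi 0 hpos).const_mul _) measurableSet_Ioi
          fun y hy => exp_stretched_le hα hq hC hp hy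
    _ = _ := by
        rw [integral_const_mul, integral_exp_mul_Ioi (by linarith) 0]
        simp [div_eq_mul_inv]

theorem integrableOn_stretched {α : ℝ} {a : ℂ} (hα : α ∈ Ioo (0:ℝ) 1) (ha : 0 < a.re) (b : ℂ) :
    IntegrableOn (fun y : ℝ => exp (b * ((y ^ α : ℝ) : ℂ) - a * y)) (Ioi 0) := by
  refine Integrable.mono' (integrableOn_exp_stretched hα ha b.re)
    (aestronglyMeasurable_stretched a b) (Eventually.of_forall fun y => ?_)
  rw [norm_stretched]

theorem norm_stretchedLaplace_le_integral {α : ℝ} (a b : ℂ) :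
    ‖stretchedLaplace α a b‖ ≤ ∫ y in Ioi (0:ℝ), Real.exp (b.re * y ^ α - a.re * y) := by
  refine (norm_integral_le_integral_norm _).trans_eq ?_
  simp_rw [norm_stretched]

theorem norm_stretchedLaplace_le {α C : ℝ} {a b : ℂ} (hα : α ∈ Ioo (0:ℝ) 1) (ha : 0 < a.re)
    (hC : 0 ≤ C) (hb : b.re ≤ a.re * C ^ (1 - α)) :
    ‖stretchedLaplace α a b‖ ≤ Real.exp (a.re * (1 - α) * C) / (a.re * (1 - α)) :=
  (norm_stretchedLaplace_le_integral a b).trans (integral_exp_stretched_le hα ha hC hb)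

theorem stretchedLaplace_conj {α : ℝ} (a b : ℂ) :
    stretchedLaplace α (starRingEnd ℂ a) (starRingEnd ℂ b) =
      starRingEnd ℂ (stretchedLaplace α a b) := by
  simp only [stretchedLaplace, ← integral_conj, ← Complex.exp_conj, map_sub, map_mul, conj_ofReal]

open Metric in
theorem hasDerivAt_stretchedLaplace_comp {α : ℝ} (hα : α ∈ Ioo (0:ℝ) 1) {a b : ℂ → ℂ} {z₀ : ℂ}
    {r : ℝ} (hr : 0 < r) (ha : DifferentiableOn ℂ a (ball z₀ r))
    (hb : DifferentiableOn ℂ b (ball z₀ r)) {p q : ℝ} (hq : 0 < q)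
    (haq : ∀ z ∈ ball z₀ r, q ≤ (a z).re) (hbp : ∀ z ∈ ball z₀ r, (b z).re ≤ p) :
    HasDerivAt (fun z => stretchedLaplace α (a z) (b z)) (∫ y in Ioi (0:ℝ),
      deriv (fun z => exp (b z * ((y ^ α : ℝ) : ℂ) - a z * y)) z₀) z₀ := by
  refine (hasDerivAt_integral_of_holomorphic hr (bound := fun y => Real.exp (p * y ^ α - q * y))
    ?_ ?_ ?_ (integrableOn_exp_stretched hα hq p)).2
  · exact Eventually.of_forall fun y => by fun_prop
  · exact fun z _ => aestronglyMeasurable_stretched _ _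
  · filter_upwards [ae_restrict_mem measurableSet_Ioi] with y hy z hz
    have hy : 0 < y := hy
    rw [norm_stretched, Real.exp_le_exp]
    have h1 := haq z hz
    have h2 := hbp z hz
    gcongr

theorem hasDerivAt_stretchedLaplace_one {α : ℝ} (hα : α ∈ Ioo (0:ℝ) 1) (b : ℂ) :
    HasDerivAt (stretchedLaplace α 1) (∫ y in Ioi (0:ℝ),
      deriv (fun z => exp (z * ((y ^ α : ℝ) : ℂ) - 1 * y)) b) b := by
  refine hasDerivAt_stretchedLaplace_comp hα (a := fun _ => 1) (b := fun z => z) one_pos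
    (p := ‖b‖ + 1) (q := 1)
    (by fun_prop) (by fun_prop) one_pos (by simp) fun z hz => ?_
  have h1 := mem_ball_iff_norm.1 hz
  have h2 := norm_add_le (z - b) b
  rw [sub_add_cancel] at h2
  linarith [re_le_norm z]

theorem differentiable_stretchedLaplace_one {α : ℝ} (hα : α ∈ Ioo (0:ℝ) 1) :
    Differentiable ℂ (stretchedLaplace α 1) :=
  fun b => (hasDerivAt_stretchedLaplace_one hα b).differentiableAt

theorem stretchedLaplace_scale_pos {α l : ℝ} (hl : 0 < l) (b : ℂ) :
    (l : ℂ) * stretchedLaplace α l ((l : ℂ) ^ (α : ℂ) * b) = stretchedLaplace α 1 b := by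
  have h := integral_comp_mul_left_Ioi
    (fun u : ℝ => exp (b * ((u ^ α : ℝ) : ℂ) - 1 * u)) 0 hl
  have h2 : stretchedLaplace α l ((l : ℂ) ^ (α : ℂ) * b) =
      ∫ y in Ioi (0:ℝ), exp (b * (((l * y) ^ α : ℝ) : ℂ) - 1 * ((l * y : ℝ) : ℂ)) := by
    refine setIntegral_congr_fun measurableSet_Ioi fun y hy => ?_
    have hy : 0 < y := hy
    rw [Real.mul_rpow hl.le hy.le, ← Complex.ofReal_cpow hl.le]
    push_cast
    ring_nf
  rw [h2, h, mul_zero, stretchedLaplace, real_smul, ofReal_inv,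
    mul_inv_cancel_left₀ (ofReal_ne_zero.2 hl.ne')]

/-- Rotation of the ray of integration. -/
theorem stretchedLaplace_scale {α : ℝ} (hα : α ∈ Ioo (0:ℝ) 1) {l : ℂ} (hl : 0 < l.re) (b : ℂ) :
    l * stretchedLaplace α l (l ^ (α : ℂ) * b) = stretchedLaplace α 1 b := by
  have hopen : IsOpen {z : ℂ | 0 < z.re} := isOpen_lt continuous_const continuous_re
  have hd : DifferentiableOn ℂ (fun l : ℂ => l * stretchedLaplace α l (l ^ (α : ℂ) * b))
      {z : ℂ | 0 < z.re} := by
    intro z hz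
    have hz : 0 < z.re := hz
    have hre : ∀ w ∈ Metric.ball z (z.re / 2), z.re / 2 ≤ w.re := by
      intro w hw
      have h1 := mem_ball_iff_norm.1 hw
      have h2 := (abs_le.1 (abs_re_le_norm (w - z))).1
      rw [sub_re] at h2
      linarith
    refine (differentiableAt_id.mul (hasDerivAt_stretchedLaplace_comp hα
      (a := fun z => z) (b := fun z => z ^ (α : ℂ) * b) (half_pos hz)
      (p := (‖z‖ + z.re / 2) ^ α * ‖b‖) (q := z.re / 2)
      (by fun_prop) ?_ (half_pos hz) hre ?_).differentiableAt).differentiableWithinAt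
    · intro w hw
      have : w ∈ slitPlane := Or.inl (by linarith [hre w hw])
      exact ((differentiableAt_id.cpow_const this).mul_const b).differentiableWithinAt
    · intro w hw
      refine (re_le_norm _).trans ?_
      rw [norm_mul, norm_cpow_real]
      gcongr
      · exact hα.1.le
      · have h1 := mem_ball_iff_norm.1 hw
        have h2 := norm_add_le (w - z) z
        rw [sub_add_cancel] at h2
        linarith
  refine AnalyticOnNhd.eqOn_of_preconnected_of_frequently_eq (z₀ := 1)
    (hd.analyticOnNhd hopen) (analyticOnNhd_const (v := stretchedLaplace α 1 b))
    (convex_halfSpace_re_gt 0).isPreconnected (by simp) ?_ hl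
  have hlim : Tendsto (fun x : ℝ => (x : ℂ)) (nhdsWithin 1 {1}ᶜ) (nhdsWithin 1 {1}ᶜ) := by
    refine tendsto_nhdsWithin_iff.2 ⟨?_, ?_⟩
    · exact (Complex.continuous_ofReal.tendsto' 1 1 (by simp)).mono_left nhdsWithin_le_nhds
    · filter_upwards [self_mem_nhdsWithin] with x hx
      simpa using hx
  refine hlim.frequently (Eventually.frequently ?_)
  filter_upwards [nhdsWithin_le_nhds (lt_mem_nhds one_pos)] with x hx
  exact stretchedLaplace_scale_pos hx b

theorem integral_stretched_sub_div {α : ℝ} (hα : α ∈ Ioo (0:ℝ) 1) (b₁ b₂ z : ℂ) :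
    ∫ y in Ioi (0:ℝ), ((exp (b₁ * (y:ℂ) ^ (α:ℂ)) - exp (b₂ * (y:ℂ) ^ (α:ℂ))) / z) * exp (-(y:ℂ)) =
      (stretchedLaplace α 1 b₁ - stretchedLaplace α 1 b₂) / z := by
  rw [stretchedLaplace, stretchedLaplace, ← integral_sub
    (integrableOn_stretched hα (by simp) b₁) (integrableOn_stretched hα (by simp) b₂),
    ← integral_div]
  refine setIntegral_congr_fun measurableSet_Ioi fun y hy => ?_
  have hy : 0 < y := hy
  simp only [Complex.ofReal_cpow hy.le, sub_eq_add_neg, Complex.exp_add, one_mul]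
  ring

theorem Galpha_eq {α : ℝ} (hα : α ∈ Ioo (0:ℝ) 1) (z : ℂ) :
    Galpha α z = (2 * Real.pi * I)⁻¹ *
      ((stretchedLaplace α 1 (-exp (-(Real.pi * α : ℂ) * I) * z ^ (1 - (α:ℂ))) -
        stretchedLaplace α 1 (-exp ((Real.pi * α : ℂ) * I) * z ^ (1 - (α:ℂ)))) / z) := by
  rw [← integral_stretched_sub_div hα, Galpha]
  simp only [mul_right_comm]

/-- The analytic continuation of `Galpha α` from the second quadrant to the left half-plane. -/
noncomputable def GalphaUp (α : ℝ) (z : ℂ) : ℂ :=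
  (2 * Real.pi * I)⁻¹ * ((stretchedLaplace α 1 ((-z) ^ (1 - (α:ℂ))) -
    stretchedLaplace α 1 (exp (-(2 * Real.pi * α : ℂ) * I) * (-z) ^ (1 - (α:ℂ)))) / (-z))

theorem cpow_eq_neg_cpow_of_re_neg {z : ℂ} (hre : z.re < 0) (him : 0 ≤ z.im) (s : ℂ) :
    z ^ s = (-z) ^ s * exp (Real.pi * I * s) := by
  have hz : z ≠ 0 := by rintro rfl; simp at hre
  have hlog : log z = log (-z) + Real.pi * I := by
    have harg : arg z = arg (-z) + Real.pi := by
      rcases him.eq_or_lt with h | h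
      · have h1 : z = -((-z.re : ℝ) : ℂ) := by apply Complex.ext <;> simp [← h]
        have h2 : arg z = Real.pi := arg_eq_pi_iff.2 ⟨hre, h.symm⟩
        have h3 : arg (-z) = 0 := by
          rw [h1, neg_neg]
          exact arg_ofReal_of_nonneg (by linarith)
        rw [h2, h3, zero_add]
      · rw [arg_neg_eq_arg_sub_pi_of_im_pos h]
        ring
    rw [log, log, norm_neg, harg]
    push_cast
    ring
  rw [cpow_def_of_ne_zero hz, cpow_def_of_ne_zero (neg_ne_zero.2 hz), hlog, ← Complex.exp_add]
  ring_nf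

theorem Galpha_eq_GalphaUp {α : ℝ} (hα : α ∈ Ioo (0:ℝ) 1) {z : ℂ} (hre : z.re < 0)
    (him : 0 ≤ z.im) : Galpha α z = GalphaUp α z := by
  have h1 : -exp (-(Real.pi * α : ℂ) * I) * exp (Real.pi * I * (1 - (α:ℂ))) =
      exp (-(2 * Real.pi * α : ℂ) * I) := by
    rw [neg_mul, ← Complex.exp_add, show -(Real.pi * α : ℂ) * I + Real.pi * I * (1 - (α:ℂ)) =
      -(2 * Real.pi * α : ℂ) * I + Real.pi * I by ring, Complex.exp_add, exp_pi_mul_I]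
    ring
  have h2 : -exp ((Real.pi * α : ℂ) * I) * exp (Real.pi * I * (1 - (α:ℂ))) = 1 := by
    rw [neg_mul, ← Complex.exp_add, show (Real.pi * α : ℂ) * I + Real.pi * I * (1 - (α:ℂ)) =
      Real.pi * I by ring, exp_pi_mul_I]
    ring
  rw [Galpha_eq hα, GalphaUp, cpow_eq_neg_cpow_of_re_neg hre him,
    mul_comm ((-z) ^ (1 - (α:ℂ))), ← mul_assoc, ← mul_assoc, h1, h2, one_mul]
  ring

theorem GalphaPlus_eq {α r : ℝ} (hα : α ∈ Ioo (0:ℝ) 1) :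
    GalphaPlus α r = GalphaUp α (-(r:ℂ)) := by
  rw [GalphaUp, neg_neg, ← integral_stretched_sub_div hα, GalphaPlus]

theorem GalphaPlus_eq_Galpha {α r : ℝ} (hα : α ∈ Ioo (0:ℝ) 1) (hr : 0 < r) :
    GalphaPlus α r = Galpha α (-(r:ℂ)) := by
  rw [GalphaPlus_eq hα, Galpha_eq_GalphaUp hα (by simpa using hr) (by simp)]

theorem differentiableAt_GalphaUp {α : ℝ} (hα : α ∈ Ioo (0:ℝ) 1) {z : ℂ} (hre : z.re < 0) :
    DifferentiableAt ℂ (GalphaUp α) z := by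
  have hz : -z ∈ slitPlane := Or.inl (by simpa using hre)
  have hp : DifferentiableAt ℂ (fun z : ℂ => (-z) ^ (1 - (α:ℂ))) z :=
    differentiableAt_id.neg.cpow_const hz
  have hF := differentiable_stretchedLaplace_one hα
  refine DifferentiableAt.const_mul (DifferentiableAt.div ?_ differentiableAt_id.neg
    (slitPlane_ne_zero hz)) _
  exact (DifferentiableAt.fun_comp' z (hF _) hp).sub
    (DifferentiableAt.fun_comp' z (hF _) (hp.const_mul _))

theorem differentiableOn_Galpha {α : ℝ} (hα : α ∈ Ioo (0:ℝ) 1) :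
    DifferentiableOn ℂ (Galpha α) slitPlane := by
  intro z hz
  have hp : DifferentiableAt ℂ (fun z : ℂ => z ^ (1 - (α:ℂ))) z :=
    differentiableAt_id.cpow_const hz
  have hF := differentiable_stretchedLaplace_one hα
  rw [show Galpha α = _ from funext (Galpha_eq hα)]
  refine (DifferentiableAt.const_mul (DifferentiableAt.div ?_ differentiableAt_id
    (slitPlane_ne_zero hz)) _).differentiableWithinAt
  exact (DifferentiableAt.fun_comp' z (hF _) (hp.const_mul _)).sub
    (DifferentiableAt.fun_comp' z (hF _) (hp.const_mul _))

theorem Galpha_conj {α : ℝ} (hα : α ∈ Ioo (0:ℝ) 1) {z : ℂ} (hz : z ∈ slitPlane) :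
    Galpha α (starRingEnd ℂ z) = starRingEnd ℂ (Galpha α z) := by
  have harg := (mem_slitPlane_iff_arg.1 hz).1
  have hp : (starRingEnd ℂ z) ^ (1 - (α:ℂ)) = starRingEnd ℂ (z ^ (1 - (α:ℂ))) := by
    rw [conj_cpow _ _ harg]
    simp
  have h1 := stretchedLaplace_conj (α := α) 1 (-exp (-(Real.pi * α : ℂ) * I) * z ^ (1 - (α:ℂ)))
  have h2 := stretchedLaplace_conj (α := α) 1 (-exp ((Real.pi * α : ℂ) * I) * z ^ (1 - (α:ℂ)))
  simp only [map_one, map_mul, map_neg, ← Complex.exp_conj, conj_ofReal, conj_I, neg_mul_neg,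
    ← hp] at h1 h2
  rw [mul_neg, ← neg_mul] at h2
  rw [Galpha_eq hα, Galpha_eq hα, map_mul, map_div₀, map_sub, ← h1, ← h2, map_inv₀, map_mul,
    map_mul, conj_I, conj_ofReal, map_ofNat, mul_neg, inv_neg]
  ring

/-- `z * Galpha α z` is given by one formula, also at `z = 0`. -/
theorem mul_Galpha {α : ℝ} (hα : α ∈ Ioo (0:ℝ) 1) (z : ℂ) :
    z * Galpha α z = (2 * Real.pi * I)⁻¹ *
      (stretchedLaplace α 1 (-exp (-(Real.pi * α : ℂ) * I) * z ^ (1 - (α:ℂ))) -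
        stretchedLaplace α 1 (-exp ((Real.pi * α : ℂ) * I) * z ^ (1 - (α:ℂ)))) := by
  rw [Galpha_eq hα]
  rcases eq_or_ne z 0 with rfl | hz
  · have : (1 - (α:ℂ)) ≠ 0 := by exact_mod_cast (sub_pos.2 hα.2).ne'
    simp [zero_cpow this]
  · field_simp

theorem norm_mul_Galpha_le {α : ℝ} (hα : α ∈ Ioo (0:ℝ) 1) (z : ℂ) :
    ‖z * Galpha α z‖ ≤ Real.exp ((1 - α) * ‖z‖) / (1 - α) := by
  have hα1 : 0 < 1 - α := by linarith [hα.2]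
  have hz : ‖z ^ (1 - (α:ℂ))‖ = ‖z‖ ^ (1 - α) := by
    rw [show (1 - (α:ℂ)) = ((1 - α : ℝ) : ℂ) by push_cast; ring, norm_cpow_real]
  have key : ∀ c : ℝ, ‖stretchedLaplace α 1 (-exp ((c : ℂ) * I) * z ^ (1 - (α:ℂ)))‖ ≤
      Real.exp ((1 - α) * ‖z‖) / (1 - α) := by
    intro c
    have := norm_stretchedLaplace_le (C := ‖z‖) (a := 1)
      (b := -exp ((c : ℂ) * I) * z ^ (1 - (α:ℂ))) hα (by simp) (norm_nonneg z) ?_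
    · simpa using this
    · refine (re_le_norm _).trans ?_
      rw [norm_mul, norm_neg, norm_exp_ofReal_mul_I, hz]
      simp
  have h1 := key (-(Real.pi * α))
  have h2 := key (Real.pi * α)
  push_cast at h1 h2
  rw [mul_Galpha hα, norm_mul]
  have hpi : ‖(2 * Real.pi * I : ℂ)⁻¹‖ ≤ 1 / 2 := by
    rw [norm_inv, norm_mul, norm_mul, norm_I, norm_real, Real.norm_of_nonneg Real.pi_pos.le]
    rw [one_div]
    apply inv_anti₀ two_pos
    simp
    linarith [Real.pi_gt_three]
  calc _ ≤ 1 / 2 * (Real.exp ((1 - α) * ‖z‖) / (1 - α) + Real.exp ((1 - α) * ‖z‖) / (1 - α)) :=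
        mul_le_mul hpi ((norm_sub_le _ _).trans (add_le_add h1 h2)) (norm_nonneg _) (by norm_num)
    _ = _ := by ring

theorem continuousAt_cpow_one_sub_zero {α : ℝ} (hα : α < 1) :
    ContinuousAt (fun z : ℂ => z ^ (1 - (α:ℂ))) 0 := by
  have h : 0 < (1 - (α:ℂ)).re := by simpa using hα
  exact (continuousAt_cpow_zero_of_re_pos h).comp (f := fun z : ℂ => (z, 1 - (α:ℂ)))
    (by fun_prop)

theorem continuousOn_cpow_upper {α : ℝ} (hα : α < 1) :
    ContinuousOn (fun z : ℂ => z ^ (1 - (α:ℂ))) {z | 0 ≤ z.im} := by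
  intro z hz
  by_cases hs : z ∈ slitPlane
  · exact (differentiableAt_id.cpow_const hs).continuousAt.continuousWithinAt
  rcases eq_or_ne z 0 with rfl | h0
  · exact (continuousAt_cpow_one_sub_zero hα).continuousWithinAt
  rw [mem_slitPlane_iff, not_or, not_lt, not_not] at hs
  have hre : z.re < 0 := lt_of_le_of_ne hs.1 fun h => h0 (Complex.ext h hs.2)
  have h1 : ContinuousAt (fun z : ℂ => (-z) ^ (1 - (α:ℂ)) * exp (Real.pi * I * (1 - (α:ℂ)))) z :=
    (differentiableAt_id.neg.cpow_const (Or.inl (by simpa using hre))).continuousAt.mul_const _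
  refine h1.continuousWithinAt.congr_of_eventuallyEq ?_
    (cpow_eq_neg_cpow_of_re_neg hre hz _)
  have hre' : ∀ᶠ w : ℂ in nhdsWithin z {z | 0 ≤ z.im}, w.re < 0 :=
    nhdsWithin_le_nhds (continuous_re.continuousAt.eventually (gt_mem_nhds hre))
  filter_upwards [hre', self_mem_nhdsWithin] with w hw hw'
  exact cpow_eq_neg_cpow_of_re_neg hw hw' _

theorem continuousOn_mul_Galpha_upper {α : ℝ} (hα : α ∈ Ioo (0:ℝ) 1) :
    ContinuousOn (fun z => z * Galpha α z) {z | 0 ≤ z.im} := by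
  have hF := (differentiable_stretchedLaplace_one hα).continuous
  have hp := continuousOn_cpow_upper hα.2
  simp only [mul_Galpha hα]
  exact continuousOn_const.mul ((hF.comp_continuousOn (continuousOn_const.mul hp)).sub
    (hF.comp_continuousOn (continuousOn_const.mul hp)))

theorem tendsto_mul_Galpha_zero {α : ℝ} (hα : α ∈ Ioo (0:ℝ) 1) :
    Tendsto (fun z => z * Galpha α z) (nhds 0) (nhds 0) := by
  have hF := (differentiable_stretchedLaplace_one hα).continuous
  have hp := continuousAt_cpow_one_sub_zero hα.2
  have h : ContinuousAt (fun z => z * Galpha α z) 0 := by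
    simp only [mul_Galpha hα]
    exact continuousAt_const.mul
      ((hF.continuousAt.comp (f := fun z : ℂ => -exp (-(Real.pi * α : ℂ) * I) * z ^ (1 - (α:ℂ)))
        (continuousAt_const.mul hp)).sub
      (hF.continuousAt.comp (f := fun z : ℂ => -exp ((Real.pi * α : ℂ) * I) * z ^ (1 - (α:ℂ)))
        (continuousAt_const.mul hp)))
  simpa [ContinuousAt] using h

/-- The exponential rate `(1 - α) α ^ (α / (1 - α))`, the maximum of `s ↦ s ^ α - s`. -/
noncomputable def expRate (α : ℝ) : ℝ := (1 - α) * α ^ (α / (1 - α))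

theorem rpow_sub_le_expRate {α s : ℝ} (hα : α ∈ Ioo (0:ℝ) 1) (hs : 0 ≤ s) :
    s ^ α - s ≤ expRate α := by
  have hα0 := hα.1
  have hα1 : 0 < 1 - α := by linarith [hα.2]
  have h := rpow_mul_rpow_le_weighted (y := s / α) (C := α ^ (α / (1 - α))) hα
    (by positivity) (by positivity)
  rw [← Real.rpow_mul hα0.le, div_mul_cancel₀ _ hα1.ne', Real.div_rpow hs hα0.le,
    div_mul_cancel₀ _ (by positivity), mul_div_cancel₀ _ hα0.ne'] at h
  rw [expRate]
  linarith

theorem stretchedLaplace_ofReal_re {α : ℝ} (p q : ℝ) :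
    stretchedLaplace α q p = ((∫ y in Ioi (0:ℝ), Real.exp (p * y ^ α - q * y) : ℝ) : ℂ) := by
  rw [stretchedLaplace, ← integral_complex_ofReal]
  push_cast
  rfl

theorem integral_exp_stretched_lt {α p₁ p₂ : ℝ} (hα : α ∈ Ioo (0:ℝ) 1) (hp : p₁ < p₂) :
    ∫ y in Ioi (0:ℝ), Real.exp (p₁ * y ^ α - 1 * y) <
      ∫ y in Ioi (0:ℝ), Real.exp (p₂ * y ^ α - 1 * y) := by
  rw [← sub_pos, ← integral_sub (integrableOn_exp_stretched hα one_pos _)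
    (integrableOn_exp_stretched hα one_pos _)]
  have hlt : ∀ y : ℝ, 0 < y →
      0 < Real.exp (p₂ * y ^ α - 1 * y) - Real.exp (p₁ * y ^ α - 1 * y) := by
    intro y hy
    rw [sub_pos, Real.exp_lt_exp]
    have := Real.rpow_pos_of_pos hy α
    nlinarith
  rw [setIntegral_pos_iff_support_of_nonneg_ae]
  · refine lt_of_lt_of_le ?_ (measure_mono (t := _) (s := Ioi (0:ℝ)) fun y hy =>
      ⟨(hlt y hy).ne', hy⟩)
    simp
  · filter_upwards [ae_restrict_mem measurableSet_Ioi] with y hy using (hlt y hy).le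
  · exact (integrableOn_exp_stretched hα one_pos _).sub (integrableOn_exp_stretched hα one_pos _)

theorem GalphaPlus_eq_ofReal {α r : ℝ} (hα : α ∈ Ioo (0:ℝ) 1) (hr : 0 < r) :
    GalphaPlus α r = (2 * Real.pi * I)⁻¹ * ((stretchedLaplace α 1 ((r ^ (1 - α) : ℝ) : ℂ) -
      stretchedLaplace α 1 (exp (((-(2 * Real.pi * α) : ℝ) : ℂ) * I) * ((r ^ (1 - α) : ℝ) : ℂ))) / r) := by
  rw [GalphaPlus_eq hα, GalphaUp, neg_neg, ofReal_cpow hr.le]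
  push_cast
  rfl

theorem GalphaPlus_im_neg {α r : ℝ} (hα : α ∈ Ioo (0:ℝ) 1) (hr : 0 < r) :
    (GalphaPlus α r).im < 0 := by
  set u : ℝ := r ^ (1 - α) with hu
  have hu0 : 0 < u := Real.rpow_pos_of_pos hr _
  have hcos : Real.cos (-(2 * Real.pi * α)) < 1 := by
    refine lt_of_le_of_ne (Real.cos_le_one _) fun h => ?_
    have hpa : 0 < 2 * Real.pi * α := mul_pos Real.two_pi_pos hα.1
    have := (Real.cos_eq_one_iff_of_lt_of_lt (x := -(2 * Real.pi * α))
      (by nlinarith [hα.2, Real.pi_pos]) (by linarith [Real.pi_pos])).1 h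
    linarith
  set X := stretchedLaplace α 1 (exp (((-(2 * Real.pi * α) : ℝ) : ℂ) * I) * (u : ℂ)) with hX
  have h1 : X.re < (stretchedLaplace α 1 (u : ℂ)).re := by
    have h2 := stretchedLaplace_ofReal_re (α := α) u 1
    rw [ofReal_one] at h2
    rw [h2, ofReal_re]
    refine ((re_le_norm _).trans (norm_stretchedLaplace_le_integral _ _)).trans_lt ?_
    rw [one_re]
    refine integral_exp_stretched_lt hα ?_
    rw [re_mul_ofReal, exp_ofReal_mul_I_re]
    nlinarith
  rw [GalphaPlus_eq_ofReal hα hr, ← hX]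
  have h3 : ((2 * Real.pi * I : ℂ))⁻¹ = ((-(2 * Real.pi)⁻¹ : ℝ) : ℂ) * I := by
    push_cast
    rw [mul_inv, inv_I]
    ring
  rw [h3, mul_assoc, im_ofReal_mul, mul_comm I, mul_I_im, div_ofReal_re, sub_re]
  have h4 : 0 < ((stretchedLaplace α 1 (u : ℂ)).re - X.re) / r := div_pos (sub_pos.2 h1) hr
  have h5 : 0 < (2 * Real.pi)⁻¹ := by positivity
  nlinarith

theorem norm_Galpha_neg_le {α r : ℝ} (hα : α ∈ Ioo (0:ℝ) 1) (hr : 1 ≤ r) :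
    ‖Galpha α (-(r:ℂ))‖ ≤
      Real.exp (expRate α * r) * ∫ y in Ioi (0:ℝ), Real.exp (1 * y ^ α - 1 * y) := by
  have hr0 : 0 < r := by linarith
  set u : ℝ := r ^ (1 - α) with hu
  have hu0 : 0 < u := Real.rpow_pos_of_pos hr0 _
  have hscale : (stretchedLaplace α 1 (u : ℂ)).re =
      r * ∫ y in Ioi (0:ℝ), Real.exp (r * y ^ α - r * y) := by
    rw [← stretchedLaplace_scale_pos hr0, ← ofReal_cpow hr0.le, ← ofReal_mul, hu,
      ← Real.rpow_add hr0, add_sub_cancel, Real.rpow_one, stretchedLaplace_ofReal_re, ← ofReal_mul,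
      ofReal_re]
  have hre : (stretchedLaplace α 1 (u : ℂ)).re = ∫ y in Ioi (0:ℝ), Real.exp (u * y ^ α - 1 * y) := by
    have h2 := stretchedLaplace_ofReal_re (α := α) u 1
    rw [ofReal_one] at h2
    rw [h2, ofReal_re]
  have hδ : 0 ≤ expRate α := by
    have h0 := hα.1
    have h1 : 0 < 1 - α := by linarith [hα.2]
    rw [expRate]
    positivity
  have hbound : ∫ y in Ioi (0:ℝ), Real.exp (r * y ^ α - r * y) ≤
      Real.exp (expRate α * r) * ∫ y in Ioi (0:ℝ), Real.exp (1 * y ^ α - 1 * y) := by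
    rw [← integral_const_mul]
    refine setIntegral_mono_on (integrableOn_exp_stretched hα hr0 _)
      ((integrableOn_exp_stretched hα one_pos _).const_mul _) measurableSet_Ioi fun y hy => ?_
    rw [← Real.exp_add, Real.exp_le_exp]
    have := rpow_sub_le_expRate hα (le_of_lt hy)
    nlinarith
  have hterm : ∀ c : ℝ, ‖stretchedLaplace α 1 (exp ((c : ℂ) * I) * (u : ℂ))‖ ≤
      (stretchedLaplace α 1 (u : ℂ)).re := by
    intro c
    refine (norm_stretchedLaplace_le_integral _ _).trans ?_
    rw [hre, one_re]
    refine setIntegral_mono_on (integrableOn_exp_stretched hα one_pos _)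
      (integrableOn_exp_stretched hα one_pos _) measurableSet_Ioi fun y hy => ?_
    have hy : 0 < y := hy
    rw [re_mul_ofReal, exp_ofReal_mul_I_re]
    have := Real.cos_le_one c
    gcongr
    nlinarith
  have h0 := hterm 0
  rw [ofReal_zero, zero_mul, Complex.exp_zero, one_mul] at h0
  have hpi : ‖(2 * Real.pi * I : ℂ)⁻¹‖ ≤ 1 / 2 := by
    rw [norm_inv, norm_mul, norm_mul, norm_I, norm_real, Real.norm_of_nonneg Real.pi_pos.le]
    rw [one_div]
    apply inv_anti₀ two_pos
    simp
    linarith [Real.pi_gt_three]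
  rw [← GalphaPlus_eq_Galpha hα hr0, GalphaPlus_eq_ofReal hα hr0, norm_mul, norm_div, norm_real,
    Real.norm_of_nonneg hr0.le]
  refine le_trans ?_ hbound
  have h1 := (norm_sub_le _ _).trans (add_le_add h0 (hterm (-(2 * Real.pi * α))))
  rw [hscale] at h1
  calc _ ≤ 1 / 2 * ((r * ∫ y in Ioi (0:ℝ), Real.exp (r * y ^ α - r * y)) +
        (r * ∫ y in Ioi (0:ℝ), Real.exp (r * y ^ α - r * y))) / r := by
        rw [← mul_div_assoc]
        gcongr
    _ = _ := by field_simp; ring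

theorem hasDerivAt_stretchedLaplace_zero {α : ℝ} (hα : α ∈ Ioo (0:ℝ) 1) :
    HasDerivAt (stretchedLaplace α 1) ((Real.Gamma (α + 1) : ℝ) : ℂ) 0 := by
  convert hasDerivAt_stretchedLaplace_one hα 0 using 1
  rw [Real.Gamma_eq_integral (by linarith [hα.1]), ← integral_complex_ofReal]
  refine setIntegral_congr_fun measurableSet_Ioi fun y hy => ?_
  have hd : HasDerivAt (fun z : ℂ => exp (z * ((y ^ α : ℝ) : ℂ) - 1 * y))
      (exp (0 * ((y ^ α : ℝ) : ℂ) - 1 * y) * (1 * ((y ^ α : ℝ) : ℂ))) 0 :=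
    (((hasDerivAt_id (0:ℂ)).mul_const _).sub_const _).cexp
  rw [hd.deriv]
  simp

theorem exists_Galpha_re_pos {α : ℝ} (hα : α ∈ Ioo (0:ℝ) 1) :
    ∃ x : ℝ, 0 < x ∧ 0 < (Galpha α x).re := by
  have hα1 : 0 < 1 - α := by linarith [hα.2]
  set c := -exp (-(Real.pi * α : ℂ) * I) with hc
  set d := -exp ((Real.pi * α : ℂ) * I) with hd
  have hF := hasDerivAt_stretchedLaplace_zero hα
  have hlin : ∀ k : ℂ, HasDerivAt (fun s : ℝ => stretchedLaplace α 1 (k * s))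
      (((Real.Gamma (α + 1) : ℝ) : ℂ) * k) 0 := by
    intro k
    have h1 : HasDerivAt (fun s : ℝ => k * (s:ℂ)) k 0 := by
      simpa using (hasDerivAt_id (0:ℝ)).ofReal_comp.const_mul k
    have hF' : HasDerivAt (stretchedLaplace α 1) ((Real.Gamma (α + 1) : ℝ) : ℂ)
        (k * ((0:ℝ):ℂ)) := by simpa using hF
    exact hF'.comp (0:ℝ) h1
  have hcd : c - d = ((2 * Real.sin (Real.pi * α) : ℝ) : ℂ) * I := by
    rw [hc, hd, show (Real.pi * α : ℂ) = ((Real.pi * α : ℝ) : ℂ) by push_cast; ring,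
      ← ofReal_neg]
    apply Complex.ext
    · simp [exp_ofReal_mul_I_re, -ofReal_mul, -ofReal_neg]
    · simp [exp_ofReal_mul_I_im, -ofReal_mul, -ofReal_neg]
      ring
  have hG : HasDerivAt (fun s : ℝ => ((2 * Real.pi * I)⁻¹ *
      (stretchedLaplace α 1 (c * s) - stretchedLaplace α 1 (d * s))).re)
      (Real.Gamma (α + 1) * Real.sin (Real.pi * α) / Real.pi) 0 := by
    have h1 := (((hlin c).sub (hlin d)).const_mul ((2 * Real.pi * I)⁻¹ : ℂ))
    have h2 : (2 * Real.pi * I : ℂ)⁻¹ * (((Real.Gamma (α + 1) : ℝ) : ℂ) * c -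
        ((Real.Gamma (α + 1) : ℝ) : ℂ) * d) =
        ((Real.Gamma (α + 1) * Real.sin (Real.pi * α) / Real.pi : ℝ) : ℂ) := by
      rw [← mul_sub, hcd]
      push_cast
      field_simp
    rw [h2] at h1
    exact Complex.reCLM.hasFDerivAt.comp_hasDerivAt (0:ℝ) h1
  have hsin : 0 < Real.sin (Real.pi * α) :=
    Real.sin_pos_of_pos_of_lt_pi (mul_pos Real.pi_pos hα.1) (by nlinarith [Real.pi_pos, hα.2])
  have hpos : 0 < Real.Gamma (α + 1) * Real.sin (Real.pi * α) / Real.pi :=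
    div_pos (mul_pos (Real.Gamma_pos_of_pos (by linarith [hα.1])) hsin) Real.pi_pos
  have hev := ((hasDerivAt_iff_tendsto_slope.1 hG).mono_left
    (nhdsWithin_mono 0 (show Ioi (0:ℝ) ⊆ {0}ᶜ from fun x hx => ne_of_gt hx))).eventually
    (lt_mem_nhds hpos)
  obtain ⟨s, hs1, hs2⟩ := (hev.and self_mem_nhdsWithin).exists
  have hs : 0 < s := hs2
  rw [slope_def_field] at hs1
  simp only [ofReal_zero, mul_zero, sub_self, zero_re, sub_zero] at hs1
  have hs3 := (div_pos_iff_of_pos_right hs).1 hs1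
  have hx : 0 < s ^ (1 / (1 - α)) := Real.rpow_pos_of_pos hs _
  refine ⟨s ^ (1 / (1 - α)), hx, ?_⟩
  have hpow : ((s ^ (1 / (1 - α)) : ℝ) : ℂ) ^ (1 - (α:ℂ)) = s := by
    rw [show (1 - (α:ℂ)) = ((1 - α : ℝ) : ℂ) by push_cast; ring, ← ofReal_cpow hx.le,
      ← Real.rpow_mul hs.le, one_div_mul_cancel hα1.ne', Real.rpow_one]
  have h := mul_Galpha hα ((s ^ (1 / (1 - α)) : ℝ) : ℂ)
  rw [hpow] at h
  rw [← h, re_ofReal_mul] at hs3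
  exact (mul_pos_iff_of_pos_left hx).1 hs3

theorem norm_stretchedLaplace_rotate_le {α β ψ R : ℝ} (hα : α ∈ Ioo (0:ℝ) 1)
    (hβ : β ∈ Ioo (-(Real.pi / 2)) (Real.pi / 2)) (hR : 0 ≤ R)
    (h : Real.cos (ψ + α * β) ≤ Real.cos β) :
    ‖stretchedLaplace α 1 (exp ((ψ : ℂ) * I) * ((R ^ (1 - α) : ℝ) : ℂ))‖ ≤
      Real.exp (Real.cos β * (1 - α) * R) / (Real.cos β * (1 - α)) := by
  have hcos : 0 < Real.cos β := Real.cos_pos_of_mem_Ioo hβ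
  have hre : (exp ((β : ℂ) * I)).re = Real.cos β := exp_ofReal_mul_I_re β
  rw [← stretchedLaplace_scale hα (l := exp ((β : ℂ) * I)) (by rw [hre]; exact hcos), norm_mul,
    norm_exp_ofReal_mul_I, one_mul, ← hre]
  refine norm_stretchedLaplace_le hα (by rw [hre]; exact hcos) hR ?_
  have hlog : log (exp ((β : ℂ) * I)) = β * I := by
    apply log_exp <;> simp <;> linarith [hβ.1, hβ.2, Real.pi_pos]
  rw [cpow_def_of_ne_zero (Complex.exp_ne_zero _), hlog, ← mul_assoc, ← Complex.exp_add,
    show (β : ℂ) * I * α + ψ * I = ((ψ + α * β : ℝ) : ℂ) * I by push_cast; ring,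
    re_mul_ofReal, exp_ofReal_mul_I_re, hre]
  gcongr

theorem exists_norm_mul_Galpha_I_le {α : ℝ} (hα : α ∈ Ioo (0:ℝ) 1) {ε : ℝ} (hε : 0 < ε) :
    ∃ C : ℝ, ∀ R : ℝ, 0 < R →
      ‖((R : ℂ) * I) * Galpha α ((R : ℂ) * I)‖ ≤ C * Real.exp (ε * R) := by
  have hα0 := hα.1
  have hα1 : 0 < 1 - α := by linarith [hα.2]
  have hpi := Real.pi_pos
  obtain ⟨η, hη0, hηε, hη4, hηα⟩ : ∃ η : ℝ, 0 < η ∧ η ≤ ε ∧ η ≤ Real.pi / 4 ∧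
      η ≤ Real.pi * (1 - α) :=
    ⟨min ε (min (Real.pi / 4) (Real.pi * (1 - α))), by positivity, min_le_left _ _,
      (min_le_right _ _).trans (min_le_left _ _), (min_le_right _ _).trans (min_le_right _ _)⟩
  have hsin : 0 < Real.sin η := Real.sin_pos_of_pos_of_lt_pi hη0 (by linarith)
  refine ⟨‖(2 * Real.pi * I : ℂ)⁻¹‖ * (2 / (Real.sin η * (1 - α))), fun R hR => ?_⟩
  have hIpow : ((R : ℂ) * I) ^ (1 - (α:ℂ)) =
      exp (((Real.pi / 2 * (1 - α) : ℝ) : ℂ) * I) * ((R ^ (1 - α) : ℝ) : ℂ) := by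
    have hlog : log ((R : ℂ) * I) = (Real.log R : ℂ) + Real.pi / 2 * I := by
      rw [log_ofReal_mul hR I_ne_zero, log_I]
    rw [cpow_def_of_ne_zero (mul_ne_zero (ofReal_ne_zero.2 hR.ne') I_ne_zero), hlog,
      ofReal_cpow hR.le, cpow_def_of_ne_zero (ofReal_ne_zero.2 hR.ne'), ← Complex.exp_add,
      ← ofReal_log hR.le]
    push_cast
    ring_nf
  have e1 : -exp (-(Real.pi * α : ℂ) * I) * ((R : ℂ) * I) ^ (1 - (α:ℂ)) =
      exp (((3 * Real.pi / 2 * (1 - α) : ℝ) : ℂ) * I) * ((R ^ (1 - α) : ℝ) : ℂ) := by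
    rw [hIpow, ← mul_assoc, neg_mul, ← Complex.exp_add, ← neg_one_mul (exp _), ← exp_pi_mul_I,
      ← Complex.exp_add]
    push_cast
    ring_nf
  have e2 : -exp ((Real.pi * α : ℂ) * I) * ((R : ℂ) * I) ^ (1 - (α:ℂ)) =
      exp (((-(Real.pi / 2 * (1 - α)) : ℝ) : ℂ) * I) * ((R ^ (1 - α) : ℝ) : ℂ) := by
    rw [hIpow, ← mul_assoc, neg_mul, ← Complex.exp_add, ← neg_one_mul (exp _),
      ← exp_neg_pi_mul_I, ← Complex.exp_add]
    push_cast
    ring_nf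
  have hE : Real.exp (Real.sin η * (1 - α) * R) ≤ Real.exp (ε * R) := by
    rw [Real.exp_le_exp]
    have h1 : Real.sin η ≤ η := Real.sin_le hη0.le
    have h2 : Real.sin η * (1 - α) ≤ ε := by nlinarith
    gcongr
  have hcos1 : Real.cos (Real.pi / 2 - η) = Real.sin η := Real.cos_pi_div_two_sub η
  have b1 := norm_stretchedLaplace_rotate_le (β := Real.pi / 2 - η)
    (ψ := 3 * Real.pi / 2 * (1 - α)) hα ⟨by linarith, by linarith⟩ hR.le (by
      have h1 : Real.cos (3 * Real.pi / 2 * (1 - α) + α * (Real.pi / 2 - η)) =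
          -Real.sin (Real.pi * α + α * η) := by
        rw [show 3 * Real.pi / 2 * (1 - α) + α * (Real.pi / 2 - η) =
          (Real.pi / 2 - (Real.pi * α + α * η)) + Real.pi by ring, Real.cos_add_pi,
          Real.cos_pi_div_two_sub]
      have h2 : 0 ≤ Real.sin (Real.pi * α + α * η) :=
        Real.sin_nonneg_of_nonneg_of_le_pi (by positivity) (by nlinarith)
      rw [h1, hcos1]
      linarith)
  have b2 := norm_stretchedLaplace_rotate_le (β := -(Real.pi / 2 - η))
    (ψ := -(Real.pi / 2 * (1 - α))) hα ⟨by linarith, by linarith⟩ hR.le (by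
      rw [show -(Real.pi / 2 * (1 - α)) + α * -(Real.pi / 2 - η) =
          -(Real.pi / 2 - α * η) by ring, Real.cos_neg, Real.cos_neg, hcos1,
          Real.cos_pi_div_two_sub]
      refine Real.sin_le_sin_of_le_of_le_pi_div_two ?_ (by linarith) (by nlinarith [hα.2])
      nlinarith)
  rw [Real.cos_neg] at b2
  rw [hcos1] at b1 b2
  rw [mul_Galpha hα, norm_mul, e1, e2]
  refine (mul_le_mul_of_nonneg_left ?_ (norm_nonneg _)).trans_eq (mul_assoc _ _ _).symm
  calc _ ≤ _ := (norm_sub_le _ _).trans (add_le_add b1 b2)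
    _ = 2 / (Real.sin η * (1 - α)) * Real.exp (Real.sin η * (1 - α) * R) := by ring
    _ ≤ _ := by gcongr

theorem integrableOn_exp_neg_mul_rpow {p b : ℝ} (hp : 0 < p) (hb : 0 < b) :
    IntegrableOn (fun v : ℝ => Real.exp (-b * v ^ p)) (Ioi 0) := by
  refine (integrableOn_rpow_mul_exp_neg_mul_rpow (s := 0) (by norm_num) hp hb).congr_fun
    (fun v hv => ?_) measurableSet_Ioi
  simp

/-- The integral of `exp (x (w - w ^ α))` along the vertical half-line going up from `z`. -/
noncomputable def verticalIntegral (α x : ℝ) (z : ℂ) : ℂ :=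
  ∫ v in Ioi (0:ℝ), exp (x * ((z + v * I) - (z + v * I) ^ (α:ℂ)))

theorem stretchedLaplace_rotate {α : ℝ} (hα : α ∈ Ioo (0:ℝ) 1) {x η : ℝ} (hx : 0 < x)
    (hη : η ∈ Ioo 0 (Real.pi / 2)) :
    stretchedLaplace α 1 (-exp ((Real.pi * α : ℂ) * I) * (x : ℂ) ^ (1 - (α:ℂ))) =
      x * exp ((η - Real.pi / 2 : ℝ) * I) * stretchedLaplace α (x * exp ((η - Real.pi / 2 : ℝ) * I))
        (-(x * exp ((α * (Real.pi / 2 + η) : ℝ) * I))) := by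
  have hcos : 0 < Real.cos (η - Real.pi / 2) := by
    apply Real.cos_pos_of_mem_Ioo
    constructor <;> linarith [hη.1, hη.2, Real.pi_pos]
  have hl : 0 < (x * exp ((η - Real.pi / 2 : ℝ) * I)).re := by
    rw [re_ofReal_mul, exp_ofReal_mul_I_re]; positivity
  rw [← stretchedLaplace_scale hα hl]
  congr 2
  have hlog : log (x * exp ((η - Real.pi / 2 : ℝ) * I)) =
      (Real.log x : ℂ) + (η - Real.pi / 2 : ℝ) * I := by
    rw [log_ofReal_mul hx (Complex.exp_ne_zero _), log_exp] <;> simp <;>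
      linarith [hη.1, hη.2, Real.pi_pos]
  have hx0 : (x:ℂ) ≠ 0 := ofReal_ne_zero.2 hx.ne'
  rw [cpow_def_of_ne_zero (mul_ne_zero hx0 (Complex.exp_ne_zero _)), hlog,
    cpow_def_of_ne_zero hx0, ← ofReal_log hx.le]
  rw [neg_mul, mul_neg, ← Complex.exp_add, ← Complex.exp_add]
  nth_rw 1 [show (x:ℂ) = exp (Real.log x) by rw [ofReal_log hx.le, exp_log hx0]]
  rw [← Complex.exp_add]
  congr 2
  push_cast
  ring

theorem stretchedLaplace_eq_verticalIntegral {α : ℝ} (hα : α ∈ Ioo (0:ℝ) 1) {x : ℝ} (hx : 0 < x) :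
    stretchedLaplace α 1 (-exp ((Real.pi * α : ℂ) * I) * (x : ℂ) ^ (1 - (α:ℂ))) =
      -(I * x * verticalIntegral α x 0) := by
  have hα0 := hα.1
  have hα1 := hα.2
  have hpi := Real.pi_pos
  set c : ℝ := Real.cos (α * (Real.pi / 2 + Real.pi / 4 * (1 - α))) with hc
  have hc0 : 0 < c := by
    apply Real.cos_pos_of_mem_Ioo
    constructor
    · have : 0 ≤ α * (Real.pi / 2 + Real.pi / 4 * (1 - α)) := by
        have : 0 ≤ 1 - α := by linarith
        positivity
      linarith
    · have : α * (2 + (1 - α)) < 2 := by nlinarith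
      nlinarith
  have hmem : ∀ᶠ η in nhdsWithin (0:ℝ) (Ioi 0), η ∈ Ioo 0 (Real.pi / 4 * (1 - α)) :=
    Ioo_mem_nhdsGT (by have : 0 < 1 - α := by linarith
                       positivity)
  have hlim : Tendsto (fun η : ℝ => x * exp ((η - Real.pi / 2 : ℝ) * I) *
      stretchedLaplace α (x * exp ((η - Real.pi / 2 : ℝ) * I))
        (-(x * exp ((α * (Real.pi / 2 + η) : ℝ) * I)))) (nhdsWithin 0 (Ioi 0))
      (nhds (x * exp (((0:ℝ) - Real.pi / 2 : ℝ) * I) *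
        ∫ v in Ioi (0:ℝ), exp (-(x * exp ((α * (Real.pi / 2 + (0:ℝ)) : ℝ) * I)) *
          ((v ^ α : ℝ) : ℂ) - (x * exp (((0:ℝ) - Real.pi / 2 : ℝ) * I)) * v))) := by
    apply Tendsto.mul
    · apply tendsto_nhdsWithin_of_tendsto_nhds
      exact Continuous.tendsto (by fun_prop) (0:ℝ)
    · unfold stretchedLaplace
      refine tendsto_integral_filter_of_dominated_convergence
        (fun v => Real.exp (-(x * c) * v ^ α)) ?_ ?_ ?_ ?_
      · exact Eventually.of_forall fun η => aestronglyMeasurable_stretched _ _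
      · filter_upwards [hmem] with η hη
        refine (ae_restrict_iff' measurableSet_Ioi).2 (Eventually.of_forall fun v hv => ?_)
        have hv : 0 < v := hv
        rw [norm_stretched, Real.exp_le_exp, neg_re, re_ofReal_mul, re_ofReal_mul,
          exp_ofReal_mul_I_re, exp_ofReal_mul_I_re]
        have h1 : c ≤ Real.cos (α * (Real.pi / 2 + η)) := by
          apply Real.cos_le_cos_of_nonneg_of_le_pi
          · have := hη.1; positivity
          · have : α * (2 + (1 - α)) < 2 := by nlinarith
            nlinarith
          · have := hη.2; gcongr
        have h2 : 0 ≤ Real.cos (η - Real.pi / 2) := by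
          apply Real.cos_nonneg_of_neg_pi_div_two_le_of_le <;> nlinarith [hη.1, hη.2]
        have h3 : 0 ≤ x * Real.cos (η - Real.pi / 2) * v := by positivity
        have h4 : x * c * v ^ α ≤ x * Real.cos (α * (Real.pi / 2 + η)) * v ^ α := by gcongr
        linarith
      · exact integrableOn_exp_neg_mul_rpow hα0 (by positivity)
      · refine Eventually.of_forall fun v => ?_
        apply tendsto_nhdsWithin_of_tendsto_nhds
        exact Continuous.tendsto (f := fun η : ℝ => exp (-(x * exp ((α * (Real.pi / 2 + η) : ℝ) * I)) *
          ((v ^ α : ℝ) : ℂ) - (x * exp ((η - Real.pi / 2 : ℝ) * I)) * v)) (by fun_prop) (0:ℝ)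
  have heq := tendsto_nhds_unique_of_eventuallyEq tendsto_const_nhds hlim (by
    filter_upwards [hmem] with η hη
    exact stretchedLaplace_rotate hα hx ⟨hη.1, hη.2.trans_le (by nlinarith)⟩)
  have hI : exp (((0:ℝ) - Real.pi / 2 : ℝ) * I) = -I := by
    push_cast
    rw [show ((0:ℂ) - Real.pi / 2) * I = -(Real.pi / 2 * I) by ring, Complex.exp_neg,
      exp_pi_div_two_mul_I, inv_I]
  rw [heq, hI, verticalIntegral, mul_neg, neg_mul, mul_comm (x:ℂ) I]
  congr 2
  refine setIntegral_congr_fun measurableSet_Ioi fun v hv => ?_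
  have hv : 0 < v := hv
  have : ((v:ℂ) * I) ^ (α:ℂ) = exp ((α * (Real.pi / 2 + (0:ℝ)) : ℝ) * I) * ((v ^ α : ℝ) : ℂ) := by
    rw [cpow_def_of_ne_zero (mul_ne_zero (ofReal_ne_zero.2 hv.ne') I_ne_zero),
      log_ofReal_mul hv I_ne_zero, log_I, ofReal_cpow hv.le,
      cpow_def_of_ne_zero (ofReal_ne_zero.2 hv.ne'), ← Complex.exp_add, ← ofReal_log hv.le]
    push_cast
    ring_nf
  simp only [zero_add, this]
  congr 1
  ring

theorem Galpha_ofReal_eq {α : ℝ} (hα : α ∈ Ioo (0:ℝ) 1) {x : ℝ} (hx : 0 < x) :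
    Galpha α x = (((verticalIntegral α x 0).re / Real.pi : ℝ) : ℂ) := by
  have h2 := stretchedLaplace_eq_verticalIntegral hα hx
  have h1 : stretchedLaplace α 1 (-exp (-(Real.pi * α : ℂ) * I) * (x : ℂ) ^ (1 - (α:ℂ))) =
      I * x * (starRingEnd ℂ) (verticalIntegral α x 0) := by
    have h3 := stretchedLaplace_conj (α := α) 1 (-exp ((Real.pi * α : ℂ) * I) * (x : ℂ) ^ (1 - (α:ℂ)))
    rw [h2] at h3
    have e : (x : ℂ) ^ (1 - (α:ℂ)) = ((x ^ (1 - α) : ℝ) : ℂ) := by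
      rw [ofReal_cpow hx.le]; push_cast; rfl
    rw [e] at h3 ⊢
    simp only [map_neg, map_mul, conj_I, conj_ofReal, ← exp_conj, map_one] at h3
    rw [show -(Real.pi * α : ℂ) * I = Real.pi * α * -I by ring, h3]
    ring
  have h := mul_Galpha hα (x:ℂ)
  rw [h1, h2] at h
  have hx0 : (x:ℂ) ≠ 0 := ofReal_ne_zero.2 hx.ne'
  have hpi : (Real.pi : ℂ) ≠ 0 := ofReal_ne_zero.2 Real.pi_ne_zero
  apply mul_left_cancel₀ hx0
  rw [h, sub_neg_eq_add, ← mul_add, add_comm ((starRingEnd ℂ) _), Complex.add_conj]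
  push_cast
  field_simp [I_ne_zero]

theorem mul_rpow_norm_le_cpow_re {α : ℝ} (hα : α ∈ Ioo (0:ℝ) 1) {w : ℂ} (hw : 0 ≤ w.re) :
    Real.cos (α * (Real.pi / 2)) * ‖w‖ ^ α ≤ (w ^ (α:ℂ)).re := by
  rw [cpow_ofReal_re, mul_comm]
  have harg : |arg w| ≤ Real.pi / 2 := abs_arg_le_pi_div_two_iff.2 hw
  gcongr
  rw [← Real.cos_abs (arg w * α), abs_mul, abs_of_pos hα.1, mul_comm |arg w|]
  apply Real.cos_le_cos_of_nonneg_of_le_pi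
  · have := hα.1; positivity
  · nlinarith [hα.1, hα.2, Real.pi_pos]
  · have := hα.1; gcongr

theorem cos_mul_pi_div_two_pos {α : ℝ} (hα : α ∈ Ioo (0:ℝ) 1) :
    0 < Real.cos (α * (Real.pi / 2)) := by
  apply Real.cos_pos_of_mem_Ioo
  constructor <;> nlinarith [hα.1, hα.2, Real.pi_pos]

theorem norm_exp_sub_cpow_le {α : ℝ} (hα : α ∈ Ioo (0:ℝ) 1) {x M v : ℝ} (hx : 0 < x) (hv : 0 ≤ v)
    {w : ℂ} (hw : 0 ≤ w.re) (hM : w.re ≤ M) (hvw : v ≤ ‖w‖) :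
    ‖exp (x * (w - w ^ (α:ℂ)))‖ ≤
      Real.exp (x * M) * Real.exp (-(x * Real.cos (α * (Real.pi / 2))) * v ^ α) := by
  rw [Complex.norm_exp, ← Real.exp_add, Real.exp_le_exp, re_ofReal_mul, sub_re]
  have h1 := mul_rpow_norm_le_cpow_re hα hw
  have h2 := (cos_mul_pi_div_two_pos hα).le
  have h3 : v ^ α ≤ ‖w‖ ^ α := Real.rpow_le_rpow hv hvw hα.1.le
  have h4 := mul_le_mul_of_nonneg_left h3 h2
  have h5 : x * (w.re - (w ^ (α:ℂ)).re) ≤ x * (M - Real.cos (α * (Real.pi / 2)) * v ^ α) := by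
    gcongr; linarith
  linarith

theorem hasDerivAt_exp_sub_cpow {α x : ℝ} {w : ℂ} (hw : w ∈ slitPlane) :
    HasDerivAt (fun w : ℂ => exp (x * (w - w ^ (α:ℂ))))
      (exp (x * (w - w ^ (α:ℂ))) * (x * (1 - α * w ^ ((α:ℂ) - 1)))) w := by
  have h := ((hasDerivAt_id w).sub (((hasDerivAt_id w).cpow_const (c := (α:ℂ)) hw))).const_mul (x:ℂ)
  simpa using h.cexp

theorem add_mul_I_mem_slitPlane (c : ℝ) {v : ℝ} (hv : 0 < v) :
    (c : ℂ) + v * I ∈ slitPlane := by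
  rw [mem_slitPlane_iff]; right; simp [hv.ne']

theorem le_norm_add_mul_I {c v : ℝ} (hv : 0 ≤ v) : v ≤ ‖(c : ℂ) + v * I‖ := by
  have := abs_im_le_norm ((c : ℂ) + v * I)
  simpa [abs_of_nonneg hv] using this

theorem tendsto_exp_neg_mul_rpow {p b : ℝ} (hp : 0 < p) (hb : 0 < b) :
    Tendsto (fun v : ℝ => Real.exp (-b * v ^ p)) atTop (nhds 0) := by
  apply Real.tendsto_exp_atBot.comp
  simp only [neg_mul]
  exact tendsto_neg_atTop_atBot.comp ((tendsto_rpow_atTop hp).const_mul_atTop hb)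

theorem measurable_exp_sub_cpow_line {α x : ℝ} (z : ℂ) :
    Measurable fun v : ℝ => exp (x * ((z + v * I) - (z + v * I) ^ (α:ℂ))) := by
  fun_prop

theorem half_le_norm_add_mul_I {c v : ℝ} {z : ℂ}
    (hz : z ∈ Metric.ball (c:ℂ) (c / 2)) : v / 2 ≤ ‖z + v * I‖ := by
  rw [mem_ball_iff_norm] at hz
  have h1 := (abs_re_le_norm (z - c)).trans_lt hz
  have h2 := (abs_im_le_norm (z - c)).trans_lt hz
  have h3 := abs_re_le_norm (z + v * I)
  have h4 := abs_im_le_norm (z + v * I)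
  simp only [sub_re, ofReal_re, sub_im, ofReal_im, add_re, mul_re, I_re, I_im, add_im, mul_im,
    mul_zero, mul_one, sub_zero, add_zero, abs_lt] at h1 h2 h3 h4
  have h5 := (le_abs_self _).trans h3
  have h6 := (le_abs_self _).trans h4
  linarith

theorem hasDerivAt_verticalIntegral {α : ℝ} (hα : α ∈ Ioo (0:ℝ) 1) {x c : ℝ} (hx : 0 < x)
    (hc : 0 < c) :
    HasDerivAt (verticalIntegral α x) (I * exp (x * (c - (c:ℂ) ^ (α:ℂ)))) c := by
  have hκ := cos_mul_pi_div_two_pos hα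
  have hre : ∀ z ∈ Metric.ball (c:ℂ) (c / 2), 0 < z.re ∧ z.re ≤ 2 * c := fun z hz => by
    rw [mem_ball_iff_norm] at hz
    have h1 := (abs_re_le_norm (z - c)).trans_lt hz
    simp only [sub_re, ofReal_re, abs_lt] at h1
    constructor <;> linarith
  have key := hasDerivAt_integral_of_holomorphic (μ := volume.restrict (Ioi (0:ℝ)))
    (f := fun z v => exp (x * ((z + v * I) - (z + v * I) ^ (α:ℂ)))) (z₀ := (c:ℂ)) (r := c / 2)
    (by positivity)
    (bound := fun v => Real.exp (x * (2 * c)) *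
      Real.exp (-(x * Real.cos (α * (Real.pi / 2))) * (v / 2) ^ α))
    (by
      refine Eventually.of_forall fun v z hz => ?_
      have hz' : z + v * I ∈ slitPlane := by
        rw [mem_slitPlane_iff]; left; simpa using (hre z hz).1
      exact ((hasDerivAt_exp_sub_cpow hz').comp_add_const z
        (v * I)).differentiableAt.differentiableWithinAt)
    (fun z _ => (measurable_exp_sub_cpow_line z).aestronglyMeasurable)
    (by
      refine (ae_restrict_iff' measurableSet_Ioi).2 (Eventually.of_forall fun v hv z hz => ?_)
      have hv : 0 < v := hv
      exact norm_exp_sub_cpow_le hα hx (by positivity) (by simpa using (hre z hz).1.le)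
        (by simpa using (hre z hz).2) (half_le_norm_add_mul_I hz))
    (by
      apply Integrable.const_mul
      refine IntegrableOn.congr_fun (integrableOn_exp_neg_mul_rpow hα.1 (b := x * Real.cos (α * (Real.pi / 2)) * (1 / 2) ^ α)
        (by positivity)) (fun v hv => ?_) measurableSet_Ioi
      have hv : 0 < v := hv
      rw [div_eq_mul_one_div v, Real.mul_rpow hv.le (by norm_num)]
      ring_nf)
  obtain ⟨hinteg, hder⟩ := key
  have hdv : ∀ v ∈ Ioi (0:ℝ), HasDerivAt
      (fun v : ℝ => exp (x * (((c:ℂ) + v * I) - ((c:ℂ) + v * I) ^ (α:ℂ))))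
      (I * deriv (fun z : ℂ => exp (x * ((z + v * I) - (z + v * I) ^ (α:ℂ)))) c) v := by
    intro v hv
    have h1 := hasDerivAt_exp_sub_cpow (α := α) (x := x) (add_mul_I_mem_slitPlane c hv)
    have h2 : HasDerivAt (fun v : ℝ => (c:ℂ) + v * I) I v := by
      simpa using ((Complex.ofRealCLM.hasDerivAt (x := v)).mul_const I).const_add (c:ℂ)
    rw [(h1.comp_add_const (c:ℂ) (v * I)).deriv]
    have h3 := h1.scomp v h2
    exact h3
  have hftc := integral_Ioi_of_hasDerivAt_of_tendsto (m := 0)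
    (f := fun v : ℝ => exp (x * (((c:ℂ) + v * I) - ((c:ℂ) + v * I) ^ (α:ℂ)))) (a := 0) ?_ hdv
    (hinteg.const_mul I) ?_
  · rw [integral_const_mul] at hftc
    refine hder.congr_deriv ?_
    have := congrArg (fun w => -I * w) hftc
    simp only [← mul_assoc, neg_mul, I_mul_I] at this
    simpa using this
  · refine ContinuousAt.continuousWithinAt ?_
    have h1 := (hasDerivAt_exp_sub_cpow (α := α) (x := x) (w := (c:ℂ) + (0:ℝ) * I) (by
      rw [mem_slitPlane_iff]; left; simpa using hc)).continuousAt
    exact ContinuousAt.comp (f := fun v : ℝ => (c:ℂ) + v * I) h1 (by fun_prop)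
  · rw [tendsto_zero_iff_norm_tendsto_zero]
    refine squeeze_zero' (Eventually.of_forall fun _ => norm_nonneg _) (g := fun v =>
      Real.exp (x * c) * Real.exp (-(x * Real.cos (α * (Real.pi / 2))) * v ^ α)) ?_ ?_
    · filter_upwards [eventually_ge_atTop 0] with v hv
      exact norm_exp_sub_cpow_le hα hx hv (by simpa using hc.le) (by simp)
        (le_norm_add_mul_I hv)
    · simpa using (tendsto_exp_neg_mul_rpow hα.1 (b := x * Real.cos (α * (Real.pi / 2)))
        (by positivity)).const_mul (Real.exp (x * c))

theorem continuousOn_verticalIntegral {α : ℝ} (hα : α ∈ Ioo (0:ℝ) 1) {x M : ℝ} (hx : 0 < x) :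
    ContinuousOn (fun c : ℝ => verticalIntegral α x c) (Icc 0 M) := by
  have hκ := cos_mul_pi_div_two_pos hα
  refine continuousOn_of_dominated (bound := fun v =>
    Real.exp (x * M) * Real.exp (-(x * Real.cos (α * (Real.pi / 2))) * v ^ α))
    (fun c _ => (measurable_exp_sub_cpow_line (c:ℂ)).aestronglyMeasurable) ?_ ?_ ?_
  · intro c hc
    refine (ae_restrict_iff' measurableSet_Ioi).2 (Eventually.of_forall fun v hv => ?_)
    have hv : 0 < v := hv
    exact norm_exp_sub_cpow_le hα hx hv.le (by simpa using hc.1) (by simpa using hc.2)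
      (le_norm_add_mul_I hv.le)
  · exact (integrableOn_exp_neg_mul_rpow hα.1 (by positivity)).const_mul _
  · refine (ae_restrict_iff' measurableSet_Ioi).2 (Eventually.of_forall fun v hv c hc => ?_)
    refine ContinuousAt.continuousWithinAt ?_
    have h1 := (hasDerivAt_exp_sub_cpow (α := α) (x := x)
      (add_mul_I_mem_slitPlane c hv)).continuousAt
    exact ContinuousAt.comp (f := fun c : ℝ => (c:ℂ) + v * I) h1 (by fun_prop)

theorem verticalIntegral_re_eq {α : ℝ} (hα : α ∈ Ioo (0:ℝ) 1) {x c : ℝ} (hx : 0 < x)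
    (hc : 0 < c) : (verticalIntegral α x c).re = (verticalIntegral α x 0).re := by
  obtain ⟨s, -, hs⟩ := exists_hasDerivAt_eq_slope (fun c : ℝ => (verticalIntegral α x c).re)
    (fun _ => 0) hc
    (Complex.continuous_re.comp_continuousOn (continuousOn_verticalIntegral hα hx)) (by
      intro s hs
      have h := (hasDerivAt_verticalIntegral hα hx hs.1).real_of_complex
      refine h.congr_deriv ?_
      rw [show (s:ℂ) ^ (α:ℂ) = ((s ^ α : ℝ) : ℂ) from (ofReal_cpow hs.1.le α).symm,
        ← ofReal_sub, ← ofReal_mul, ← ofReal_exp]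
      simp only [I_mul_re, ofReal_im, neg_zero])
  have : c - 0 ≠ 0 := by linarith
  rw [eq_comm, div_eq_zero_iff] at hs
  have := hs.resolve_right this
  simp only [ofReal_zero] at this
  linarith

theorem rpow_lt_cpow_add_mul_I_re {α : ℝ} (hα : α ∈ Ioo (0:ℝ) 1) {c v : ℝ} (hc : 0 < c)
    (hv : 0 < v) : c ^ α < (((c:ℂ) + v * I) ^ (α:ℂ)).re := by
  have hmem : ∀ s : ℝ, (c:ℂ) + s * I ∈ slitPlane := fun s => by
    rw [mem_slitPlane_iff]; left; simpa using hc
  have hder : ∀ s : ℝ, HasDerivAt (fun s : ℝ => (((c:ℂ) + s * I) ^ (α:ℂ)).re)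
      (I * (α * ((c:ℂ) + s * I) ^ ((α - 1 : ℝ) : ℂ))).re s := by
    intro s
    have h2 : HasDerivAt (fun v : ℝ => (c:ℂ) + v * I) I s := by
      simpa using ((Complex.ofRealCLM.hasDerivAt (x := s)).mul_const I).const_add (c:ℂ)
    have h1 := (hasDerivAt_id ((c:ℂ) + s * I)).cpow_const (c := (α:ℂ)) (hmem s)
    have h3 := h1.scomp s h2
    have h4 := Complex.reCLM.hasFDerivAt.comp_hasDerivAt s h3
    refine h4.congr_deriv ?_
    simp
  have hmono : StrictMonoOn (fun s : ℝ => (((c:ℂ) + s * I) ^ (α:ℂ)).re) (Ici 0) := by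
    refine strictMonoOn_of_deriv_pos (convex_Ici 0)
      (fun s _ => (hder s).continuousAt.continuousWithinAt) fun s hs => ?_
    rw [interior_Ici] at hs
    have hs : 0 < s := hs
    rw [(hder s).deriv, I_mul_re, im_ofReal_mul, cpow_ofReal_im]
    have harg : 0 < arg ((c:ℂ) + s * I) := by
      have h0 : 0 ≤ arg ((c:ℂ) + s * I) := arg_nonneg_iff.2 (by simpa using hs.le)
      refine h0.lt_of_ne fun h => ?_
      have := (arg_eq_zero_iff.1 h.symm).2
      simp at this
      exact hs.ne' this
    have hpos : 0 < ‖(c:ℂ) + s * I‖ := norm_pos_iff.2 (slitPlane_ne_zero (hmem s))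
    have hsin : 0 < Real.sin ((1 - α) * arg ((c:ℂ) + s * I)) := by
      apply Real.sin_pos_of_pos_of_lt_pi
      · have : 0 < 1 - α := by linarith [hα.2]
        positivity
      · nlinarith [hα.1, hα.2, arg_le_pi ((c:ℂ) + s * I), mul_pos hα.1 harg]
    have : arg ((c:ℂ) + s * I) * (α - 1) = -((1 - α) * arg ((c:ℂ) + s * I)) := by ring
    rw [this, Real.sin_neg]
    have := hα.1
    have : 0 < α * (‖(c:ℂ) + s * I‖ ^ (α - 1) * Real.sin ((1 - α) * arg ((c:ℂ) + s * I))) := by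
      positivity
    linarith
  have h := hmono (mem_Ici.2 le_rfl) (mem_Ici.2 hv.le) hv
  simpa [← ofReal_cpow hc.le] using h

/-- The excess of `Re ((w + i v) ^ α)` over `w ^ α`, where `w = α ^ (1 / (1 - α))` is the critical
point of `w ↦ w - w ^ α`. -/
noncomputable def saddleDecay (α v : ℝ) : ℝ :=
  ((((α ^ (1 / (1 - α)) : ℝ) : ℂ) + v * I) ^ (α:ℂ)).re - (α ^ (1 / (1 - α))) ^ α

theorem saddleDecay_pos {α v : ℝ} (hα : α ∈ Ioo (0:ℝ) 1) (hv : 0 < v) : 0 < saddleDecay α v :=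
  sub_pos.2 (rpow_lt_cpow_add_mul_I_re hα (Real.rpow_pos_of_pos hα.1 _) hv)

theorem integrableOn_exp_neg_saddleDecay {α : ℝ} (hα : α ∈ Ioo (0:ℝ) 1) :
    IntegrableOn (fun v => Real.exp (-saddleDecay α v)) (Ioi 0) := by
  have hκ := cos_mul_pi_div_two_pos hα
  have hw : 0 < α ^ (1 / (1 - α)) := Real.rpow_pos_of_pos hα.1 _
  refine ((integrableOn_exp_neg_mul_rpow hα.1 hκ).const_mul
    (Real.exp ((α ^ (1 / (1 - α))) ^ α))).mono' ?_ ?_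
  · unfold saddleDecay
    exact Measurable.aestronglyMeasurable (by fun_prop)
  · refine (ae_restrict_iff' measurableSet_Ioi).2 (Eventually.of_forall fun v hv => ?_)
    have hv : 0 < v := hv
    rw [Real.norm_of_nonneg (Real.exp_pos _).le, ← Real.exp_add, Real.exp_le_exp, saddleDecay]
    have h1 := mul_rpow_norm_le_cpow_re hα (w := ((α ^ (1 / (1 - α)) : ℝ) : ℂ) + v * I)
      (by simpa using hw.le)
    have h2 : v ^ α ≤ ‖((α ^ (1 / (1 - α)) : ℝ) : ℂ) + v * I‖ ^ α :=
      Real.rpow_le_rpow hv.le (le_norm_add_mul_I hv.le) hα.1.le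
    have h3 := mul_le_mul_of_nonneg_left h2 hκ.le
    linarith

theorem norm_Galpha_ofReal_le {α : ℝ} (hα : α ∈ Ioo (0:ℝ) 1) {x : ℝ} (hx : 1 ≤ x) :
    ‖Galpha α x‖ * Real.exp (expRate α * x) ≤
      ∫ v in Ioi (0:ℝ), Real.exp (-(x * saddleDecay α v)) := by
  have hx0 : 0 < x := by linarith
  have hα0 := hα.1
  have hα1 : 0 < 1 - α := by linarith [hα.2]
  set w : ℝ := α ^ (1 / (1 - α)) with hwdef
  have hw : 0 < w := Real.rpow_pos_of_pos hα.1 _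
  have hδ : w - w ^ α = -expRate α := by
    have h1 : w ^ α = α ^ (α / (1 - α)) := by
      rw [hwdef, ← Real.rpow_mul hα0.le]; congr 1; ring
    have h2 : w = α * α ^ (α / (1 - α)) := by
      rw [hwdef, show 1 / (1 - α) = 1 + α / (1 - α) by field_simp; ring,
        Real.rpow_add hα0, Real.rpow_one]
    rw [h1, expRate]
    linear_combination h2
  have hinteg : ‖verticalIntegral α x w‖ ≤
      ∫ v in Ioi (0:ℝ), Real.exp (-(expRate α * x)) * Real.exp (-(x * saddleDecay α v)) := by
    refine (norm_integral_le_integral_norm _).trans_eq ?_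
    refine integral_congr_ae (Eventually.of_forall fun v => ?_)
    simp only
    rw [Complex.norm_exp, ← Real.exp_add, re_ofReal_mul, sub_re, saddleDecay, ← hwdef]
    congr 1
    simp only [add_re, ofReal_re, mul_re, I_re, I_im, ofReal_im]
    linear_combination x * hδ
  rw [integral_const_mul] at hinteg
  rw [Galpha_ofReal_eq hα hx0, ← verticalIntegral_re_eq hα hx0 hw, norm_real, norm_div,
    Real.norm_of_nonneg Real.pi_pos.le]
  have h1 : ‖(verticalIntegral α x w).re‖ / Real.pi ≤ ‖verticalIntegral α x w‖ :=
    (div_le_self (norm_nonneg _) (by linarith [Real.pi_gt_three])).trans (abs_re_le_norm _)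
  calc _ ≤ (Real.exp (-(expRate α * x)) * ∫ v in Ioi (0:ℝ), Real.exp (-(x * saddleDecay α v))) *
        Real.exp (expRate α * x) := by gcongr; exact h1.trans hinteg
    _ = _ := by
      rw [mul_right_comm, ← Real.exp_add]; simp

theorem measurable_saddleDecay (α : ℝ) : Measurable (saddleDecay α) := by
  unfold saddleDecay
  fun_prop

theorem tendsto_norm_Galpha_mul_exp {α : ℝ} (hα : α ∈ Ioo (0:ℝ) 1) :
    Tendsto (fun x : ℝ => ‖Galpha α x‖ * Real.exp (expRate α * x)) atTop (nhds 0) := by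
  have h : Tendsto (fun x : ℝ => ∫ v in Ioi (0:ℝ), Real.exp (-(x * saddleDecay α v))) atTop
      (nhds (∫ _ in Ioi (0:ℝ), 0)) := by
    refine tendsto_integral_filter_of_dominated_convergence
      (fun v => Real.exp (-saddleDecay α v)) ?_ ?_ (integrableOn_exp_neg_saddleDecay hα) ?_
    · have := measurable_saddleDecay α
      exact Eventually.of_forall fun x => Measurable.aestronglyMeasurable (by fun_prop)
    · filter_upwards [eventually_ge_atTop 1] with x hx
      refine (ae_restrict_iff' measurableSet_Ioi).2 (Eventually.of_forall fun v hv => ?_)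
      have := saddleDecay_pos hα hv
      rw [Real.norm_of_nonneg (Real.exp_pos _).le, Real.exp_le_exp]
      nlinarith
    · refine (ae_restrict_iff' measurableSet_Ioi).2 (Eventually.of_forall fun v hv => ?_)
      exact Real.tendsto_exp_neg_atTop_nhds_zero.comp
        (tendsto_id.atTop_mul_const (saddleDecay_pos hα hv))
  rw [integral_zero] at h
  refine squeeze_zero' (Eventually.of_forall fun _ => by positivity) ?_ h
  filter_upwards [eventually_ge_atTop 1] with x hx
  exact norm_Galpha_ofReal_le hα hx

theorem exists_norm_Galpha_mul_exp_le {α : ℝ} (hα : α ∈ Ioo (0:ℝ) 1) :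
    ∃ C : ℝ, ∀ x : ℝ, 1 ≤ x → ‖Galpha α x‖ * Real.exp (expRate α * x) ≤ C := by
  refine ⟨_, fun x hx => (norm_Galpha_ofReal_le hα hx).trans
    (integral_mono_of_nonneg (g := fun v => Real.exp (-saddleDecay α v))
      (Eventually.of_forall fun _ => (Real.exp_pos _).le)
      (integrableOn_exp_neg_saddleDecay hα) ?_)⟩
  refine (ae_restrict_iff' measurableSet_Ioi).2 (Eventually.of_forall fun v hv => ?_)
  have := saddleDecay_pos hα hv
  simp only [Real.exp_le_exp]
  nlinarith

theorem expRate_nonneg {α : ℝ} (hα : α ∈ Ioo (0:ℝ) 1) : 0 ≤ expRate α :=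
  mul_nonneg (by linarith [hα.2]) (Real.rpow_nonneg hα.1.le _)

theorem norm_exp_le_exp_mul_norm {c : ℝ} (hc : 0 ≤ c) (z : ℂ) :
    ‖exp ((c:ℂ) * z)‖ ≤ Real.exp (c * ‖z‖) := by
  rw [Complex.norm_exp, re_ofReal_mul, Real.exp_le_exp]
  gcongr
  exact re_le_norm z

theorem exists_norm_mul_Galpha_mul_exp_real_le {α : ℝ} (hα : α ∈ Ioo (0:ℝ) 1) :
    ∃ C : ℝ, ∀ x : ℝ, ‖(x:ℂ) * Galpha α x * exp (expRate α * x)‖ ≤ C * ‖(x:ℂ) + I‖ := by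
  have hα1 : 0 < 1 - α := by linarith [hα.2]
  obtain ⟨C₁, hC₁⟩ := exists_norm_Galpha_mul_exp_le hα
  set C₂ := ∫ y in Ioi (0:ℝ), Real.exp (1 * y ^ α - 1 * y) with hC₂
  set C₃ := Real.exp (1 - α) / (1 - α) * Real.exp (expRate α) with hC₃
  have hδ := expRate_nonneg hα
  have hexp : ∀ x : ℝ, ‖exp (expRate α * (x:ℂ))‖ = Real.exp (expRate α * x) := fun x => by
    rw [Complex.norm_exp, re_ofReal_mul, ofReal_re]
  refine ⟨max C₁ (max C₂ C₃), fun x => ?_⟩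
  have hx1 : |x| ≤ ‖(x:ℂ) + I‖ := by
    have := abs_re_le_norm ((x:ℂ) + I)
    simpa using this
  have hx2 : 1 ≤ ‖(x:ℂ) + I‖ := by
    have := abs_im_le_norm ((x:ℂ) + I)
    simpa using this
  have hC0 : 0 ≤ max C₁ (max C₂ C₃) :=
    le_max_of_le_right (le_max_of_le_right (by positivity))
  have hlarge : ‖Galpha α x‖ * Real.exp (expRate α * x) ≤ max C₁ (max C₂ C₃) →
      ‖(x:ℂ) * Galpha α x * exp (expRate α * x)‖ ≤ max C₁ (max C₂ C₃) * ‖(x:ℂ) + I‖ := by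
    intro h
    rw [norm_mul, norm_mul, hexp, norm_real, Real.norm_eq_abs, mul_assoc, mul_comm]
    gcongr
  rcases le_or_gt 1 x with h | h
  · exact hlarge ((hC₁ x h).trans (le_max_left _ _))
  rcases le_or_gt x (-1) with h' | h'
  · apply hlarge
    have h1 := norm_Galpha_neg_le hα (r := -x) (by linarith)
    rw [ofReal_neg, neg_neg] at h1
    refine le_trans ?_ ((le_max_left C₂ C₃).trans (le_max_right _ _))
    calc _ ≤ Real.exp (expRate α * -x) * C₂ * Real.exp (expRate α * x) := by gcongr
      _ = C₂ := by rw [mul_right_comm, ← Real.exp_add]; simp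
  · have hn : ‖(x:ℂ)‖ ≤ 1 := by
      rw [norm_real, Real.norm_eq_abs, abs_le]; constructor <;> linarith
    calc ‖(x:ℂ) * Galpha α x * exp (expRate α * x)‖
        ≤ Real.exp ((1 - α) * ‖(x:ℂ)‖) / (1 - α) * Real.exp (expRate α * ‖(x:ℂ)‖) := by
          rw [norm_mul]
          gcongr
          · exact norm_mul_Galpha_le hα x
          · exact norm_exp_le_exp_mul_norm hδ x
      _ ≤ C₃ := by
          rw [hC₃]
          gcongr
          · nlinarith
          · nlinarith
      _ ≤ max C₁ (max C₂ C₃) := (le_max_right _ _).trans (le_max_right _ _)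
      _ ≤ _ := le_mul_of_one_le_right hC0 hx2

theorem norm_I_mul_add_I_ge {ζ : ℂ} (hζ : 0 ≤ ζ.re) : 1 ≤ ‖I * ζ + I‖ := by
  have := abs_im_le_norm (I * ζ + I)
  rw [add_im, I_mul_im, I_im, abs_of_nonneg (by linarith)] at this
  linarith

theorem norm_mul_Galpha_mul_exp_le_of_im_nonneg {α C : ℝ} (hα : α ∈ Ioo (0:ℝ) 1)
    (hC : ∀ x : ℝ, ‖(x:ℂ) * Galpha α x * exp (expRate α * x)‖ ≤ C * ‖(x:ℂ) + I‖)
    {z : ℂ} (hz : 0 ≤ z.im) :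
    ‖z * Galpha α z * exp (expRate α * z)‖ ≤ C * ‖z + I‖ := by
  have hα1 : 0 < 1 - α := by linarith [hα.2]
  have hδ := expRate_nonneg hα
  set f : ℂ → ℂ := fun ζ =>
    (I * ζ) * Galpha α (I * ζ) * exp (expRate α * (I * ζ)) / (I * ζ + I) with hf
  have hne : ∀ ζ : ℂ, 0 ≤ ζ.re → I * ζ + I ≠ 0 := fun ζ hζ =>
    norm_pos_iff.1 (one_pos.trans_le (norm_I_mul_add_I_ge hζ))
  have hclos : closure {ζ : ℂ | 0 < ζ.re} = {ζ : ℂ | 0 ≤ ζ.re} := closure_setOfPred_lt_re 0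
  have hd : DiffContOnCl ℂ f {ζ : ℂ | 0 < ζ.re} := by
    constructor
    · intro ζ hζ
      have hζ : 0 < ζ.re := hζ
      have hmem : I * ζ ∈ slitPlane := by
        rw [mem_slitPlane_iff]; right; rw [I_mul_im]; exact hζ.ne'
      have hG : DifferentiableAt ℂ (fun ζ => Galpha α (I * ζ)) ζ :=
        DifferentiableAt.comp (g := Galpha α) ζ
          ((differentiableOn_Galpha hα).differentiableAt (isOpen_slitPlane.mem_nhds hmem))
          (by fun_prop)
      apply DifferentiableAt.differentiableWithinAt
      have := hne ζ hζ.le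
      fun_prop (disch := assumption)
    · rw [hclos]
      refine ContinuousOn.div (ContinuousOn.mul ?_ (by fun_prop)) (by fun_prop)
        fun ζ hζ => hne ζ hζ
      refine (continuousOn_mul_Galpha_upper hα).comp (by fun_prop) fun ζ hζ => ?_
      have hζ : 0 ≤ ζ.re := hζ
      simpa using hζ
  have hbound : ∀ ζ : ℂ, 0 ≤ ζ.re →
      ‖f ζ‖ ≤ 1 / (1 - α) * Real.exp (((1 - α) + expRate α) * ‖ζ‖) := by
    intro ζ hζ
    have h1 := norm_mul_Galpha_le hα (I * ζ)
    have h2 := norm_exp_le_exp_mul_norm hδ (I * ζ)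
    rw [hf, norm_div, norm_mul]
    refine (div_le_self (by positivity) (norm_I_mul_add_I_ge hζ)).trans ?_
    calc _ ≤ Real.exp ((1 - α) * ‖I * ζ‖) / (1 - α) * Real.exp (expRate α * ‖I * ζ‖) := by
          gcongr
      _ = _ := by
        rw [norm_mul, norm_I, one_mul, add_mul, Real.exp_add]; ring
  have hε : ∀ ε : ℝ, 0 < ε → ∀ ζ : ℂ, 0 ≤ ζ.re → ‖exp (-(ε * ζ)) * f ζ‖ ≤ C := by
    intro ε hε ζ hζ
    have hnorm : ∀ ζ : ℂ, ‖exp (-(ε * ζ))‖ = Real.exp (-(ε * ζ.re)) := fun ζ => by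
      rw [Complex.norm_exp, neg_re, re_ofReal_mul]
    refine PhragmenLindelof.right_half_plane_of_bounded_on_real
      (f := fun ζ => exp (-(ε * ζ)) * f ζ) ?_ ⟨1, one_lt_two, (1 - α) + expRate α, ?_⟩ ?_ ?_ hζ
    · exact DiffContOnCl.smul (𝕜' := ℂ) (Differentiable.diffContOnCl (by fun_prop)) hd
    · refine Asymptotics.IsBigO.of_bound (1 / (1 - α)) ?_
      refine eventually_inf_principal.2 (Eventually.of_forall fun ζ hζ => ?_)
      have hζ : 0 < ζ.re := hζ
      rw [norm_mul, hnorm, Real.norm_of_nonneg (Real.exp_pos _).le, Real.rpow_one]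
      refine (mul_le_of_le_one_left (norm_nonneg _) ?_).trans (hbound ζ hζ.le)
      exact Real.exp_le_one_iff.2 (by nlinarith)
    · obtain ⟨K, hK⟩ := exists_norm_mul_Galpha_I_le hα hε
      refine isBoundedUnder_of_eventually_le (a := K) ?_
      filter_upwards [eventually_gt_atTop 0] with R hR
      have h1 := hK R hR
      have h2 : ‖exp (expRate α * (I * R))‖ = 1 := by
        rw [show (expRate α : ℂ) * (I * R) = ((expRate α * R : ℝ) : ℂ) * I by push_cast; ring,
          norm_exp_ofReal_mul_I]
      rw [norm_mul, hnorm, hf, norm_div, norm_mul, h2, mul_one, ofReal_re, mul_comm I]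
      have h3 : 1 ≤ ‖(R:ℂ) * I + I‖ := by
        have := norm_I_mul_add_I_ge (ζ := (R:ℂ)) (by simpa using hR.le)
        rwa [mul_comm I] at this
      calc _ ≤ Real.exp (-(ε * R)) * (K * Real.exp (ε * R)) := by
            gcongr
            exact (div_le_self (norm_nonneg _) h3).trans h1
        _ = K := by rw [mul_left_comm, ← Real.exp_add]; simp
    · intro t
      have h1 : I * ((t:ℂ) * I) = ((-t : ℝ) : ℂ) := by
        push_cast; linear_combination (t:ℂ) * I_mul_I
      have h2 := hC (-t)
      have h3 : 0 < ‖((-t : ℝ) : ℂ) + I‖ := by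
        have := abs_im_le_norm (((-t : ℝ) : ℂ) + I)
        rw [add_im, ofReal_im, I_im, zero_add, abs_one] at this
        linarith
      rw [norm_mul, hnorm, hf]
      simp only [h1, norm_div, mul_re, ofReal_re, I_re, mul_zero, ofReal_im, I_im, zero_mul, sub_self, neg_zero,
        Real.exp_zero, one_mul]
      rwa [div_le_iff₀ h3]
  have hlim : ‖f (-I * z)‖ ≤ C := by
    have ht : Tendsto (fun ε : ℝ => ‖exp (-(ε * (-I * z))) * f (-I * z)‖)
        (nhdsWithin 0 (Ioi 0)) (nhds ‖exp (-(((0:ℝ):ℂ) * (-I * z))) * f (-I * z)‖) := by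
      apply tendsto_nhdsWithin_of_tendsto_nhds
      exact Continuous.tendsto (f := fun ε : ℝ => ‖exp (-(ε * (-I * z))) * f (-I * z)‖)
        (by fun_prop) (0:ℝ)
    have := le_of_tendsto ht (eventually_nhdsWithin_of_forall fun ε hε' =>
      hε ε hε' (-I * z) (by simpa using hz))
    simpa using this
  have hz' : I * (-I * z) = z := by linear_combination (-z) * I_mul_I
  rw [hf] at hlim
  simp only [hz', norm_div] at hlim
  have h1 : 0 < ‖z + I‖ := by
    have := abs_im_le_norm (z + I)
    rw [add_im, I_im, abs_of_nonneg (by linarith)] at this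
    linarith
  rwa [div_le_iff₀ h1] at hlim

theorem exists_norm_mul_Galpha_mul_exp_le {α : ℝ} (hα : α ∈ Ioo (0:ℝ) 1) :
    ∃ C : ℝ, 0 ≤ C ∧ ∀ z ∈ slitPlane,
      ‖z * Galpha α z * exp (expRate α * z)‖ ≤ C * (‖z‖ + 1) := by
  obtain ⟨C, hC⟩ := exists_norm_mul_Galpha_mul_exp_real_le hα
  have hC0 : 0 ≤ C := by
    have := (norm_nonneg _).trans (hC 0)
    simpa using this
  have hup : ∀ z : ℂ, 0 ≤ z.im → ‖z * Galpha α z * exp (expRate α * z)‖ ≤ C * (‖z‖ + 1) := by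
    intro z hz
    refine (norm_mul_Galpha_mul_exp_le_of_im_nonneg hα hC hz).trans ?_
    gcongr
    exact (norm_add_le _ _).trans_eq (by simp)
  refine ⟨C, hC0, fun z hz => ?_⟩
  rcases le_total 0 z.im with h | h
  · exact hup z h
  · have h1 := hup ((starRingEnd ℂ) z) (by simpa using h)
    rw [Galpha_conj hα hz] at h1
    rw [show (expRate α : ℂ) * (starRingEnd ℂ) z = (starRingEnd ℂ) (expRate α * z) by simp,
      exp_conj, ← map_mul, ← map_mul, norm_conj, norm_conj] at h1
    exact h1

theorem norm_sq_sub_sq_of_norm_eq {w : ℂ} {r : ℝ} (hw : ‖w‖ = r) :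
    ‖w ^ 2 - (r:ℂ) ^ 2‖ = 2 * r * |w.im| := by
  have h1 : (r:ℂ) ^ 2 = w * (starRingEnd ℂ) w := by
    rw [mul_conj, normSq_eq_norm_sq, hw]; push_cast; rfl
  have h2 : w - (starRingEnd ℂ) w = ((2 * w.im : ℝ) : ℂ) * I := sub_conj w
  rw [h1, show w ^ 2 - w * (starRingEnd ℂ) w = w * (w - (starRingEnd ℂ) w) by ring, h2, norm_mul,
    norm_mul, norm_I, mul_one, norm_real, Real.norm_eq_abs, abs_mul, hw, abs_two]
  ring

theorem norm_mul_le_of_norm_le_div_im {E : ℂ → ℂ} {C : ℝ} (hE : DifferentiableOn ℂ E {0}ᶜ)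
    (hC : ∀ z : ℂ, z.im ≠ 0 → ‖E z‖ ≤ C * (1 + ‖z‖) ^ 2 / |z.im|) {z : ℂ} (hz : z ≠ 0) :
    ‖z * E z‖ ≤ 8 * C * (1 + 2 * ‖z‖) ^ 2 := by
  have hC0 : 0 ≤ C := by
    have := (norm_nonneg _).trans (hC I (by simp))
    simp only [norm_I, I_im, abs_one, div_one] at this
    linarith
  have hs : 0 < ‖z‖ := norm_pos_iff.2 hz
  set s := ‖z‖ with hsdef
  set U : Set ℂ := {w | s / 2 < ‖w‖ ∧ ‖w‖ < 2 * s} with hU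
  have hUo : IsOpen U := (isOpen_lt continuous_const continuous_norm).inter
    (isOpen_lt continuous_norm continuous_const)
  have hUc : closure U ⊆ {w | s / 2 ≤ ‖w‖ ∧ ‖w‖ ≤ 2 * s} := by
    refine closure_minimal (fun w hw => ⟨hw.1.le, hw.2.le⟩) ?_
    exact (isClosed_le continuous_const continuous_norm).inter
      (isClosed_le continuous_norm continuous_const)
  set h : ℂ → ℂ := fun w => (w ^ 2 - ((2 * s : ℝ) : ℂ) ^ 2) * (w ^ 2 - ((s / 2 : ℝ) : ℂ) ^ 2) / w * E w
    with hh
  have hd : DiffContOnCl ℂ h U := by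
    apply DifferentiableOn.diffContOnCl
    have hne : ∀ w ∈ closure U, w ≠ 0 := fun w hw => by
      have := (hUc hw).1
      exact norm_pos_iff.1 (by linarith)
    refine DifferentiableOn.mul (DifferentiableOn.div (by fun_prop) (by fun_prop) hne) ?_
    exact hE.mono fun w hw => hne w hw
  have hEim : ∀ w : ℂ, ‖w‖ ≤ 2 * s → |w.im| * ‖E w‖ ≤ C * (1 + 2 * s) ^ 2 := by
    intro w hw
    by_cases him : w.im = 0
    · rw [him, abs_zero, zero_mul]; positivity
    · have h1 := hC w him
      rw [le_div_iff₀ (abs_pos.2 him)] at h1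
      rw [mul_comm]
      refine h1.trans ?_
      gcongr
  have hfr : ∀ w ∈ frontier U, ‖h w‖ ≤ 2 * (5 * s ^ 2) * (C * (1 + 2 * s) ^ 2) := by
    intro w hw
    rw [hUo.frontier_eq] at hw
    have h1 := hUc hw.1
    have hle := hEim w h1.2
    have hw0 : 0 < ‖w‖ := by linarith [h1.1]
    have htri : ∀ r : ℝ, ‖w ^ 2 - (r:ℂ) ^ 2‖ ≤ ‖w‖ ^ 2 + r ^ 2 := fun r => by
      refine (norm_sub_le _ _).trans_eq ?_
      rw [norm_pow, norm_pow, norm_real, Real.norm_eq_abs, sq_abs]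
    have hcase : ‖w‖ = 2 * s ∨ ‖w‖ = s / 2 := by
      by_contra hcon
      push Not at hcon
      exact hw.2 ⟨h1.1.lt_of_ne hcon.2.symm, h1.2.lt_of_ne hcon.1⟩
    rw [hh]
    simp only [norm_mul, norm_div]
    rcases hcase with hcase | hcase
    · rw [norm_sq_sub_sq_of_norm_eq hcase]
      have h2 : ‖w ^ 2 - ((s / 2 : ℝ) : ℂ) ^ 2‖ ≤ 5 * s ^ 2 := by
        refine (htri _).trans ?_
        rw [hcase]; nlinarith
      rw [hcase]
      calc _ = 2 * ‖w ^ 2 - ((s / 2 : ℝ) : ℂ) ^ 2‖ * (|w.im| * ‖E w‖) := by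
            field_simp
        _ ≤ _ := by gcongr
    · rw [norm_sq_sub_sq_of_norm_eq hcase]
      have h2 : ‖w ^ 2 - ((2 * s : ℝ) : ℂ) ^ 2‖ ≤ 5 * s ^ 2 := by
        refine (htri _).trans ?_
        rw [hcase]; nlinarith
      rw [hcase]
      calc _ = 2 * ‖w ^ 2 - ((2 * s : ℝ) : ℂ) ^ 2‖ * (|w.im| * ‖E w‖) := by
            field_simp
        _ ≤ _ := by gcongr
  have hbd : Bornology.IsBounded U := by
    refine (Metric.isBounded_ball (x := (0:ℂ)) (r := 2 * s)).subset fun w hw => ?_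
    simpa using hw.2
  have hzU : z ∈ closure U := subset_closure ⟨by linarith, by linarith⟩
  have hmax := Complex.norm_le_of_forall_mem_frontier_norm_le hbd hd hfr hzU
  have hlow : ∀ r : ℝ, |s ^ 2 - r ^ 2| ≤ ‖z ^ 2 - (r:ℂ) ^ 2‖ := fun r => by
    have := abs_norm_sub_norm_le (z ^ 2) ((r:ℂ) ^ 2)
    rwa [norm_pow, norm_pow, norm_real, Real.norm_eq_abs, sq_abs] at this
  have hl1 : 3 * s ^ 2 ≤ ‖z ^ 2 - ((2 * s : ℝ) : ℂ) ^ 2‖ := by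
    refine le_trans ?_ (hlow _)
    rw [show s ^ 2 - (2 * s) ^ 2 = -(3 * s ^ 2) by ring, abs_neg]
    exact le_abs_self _
  have hl2 : 3 / 4 * s ^ 2 ≤ ‖z ^ 2 - ((s / 2 : ℝ) : ℂ) ^ 2‖ := by
    refine le_trans ?_ (hlow _)
    rw [show s ^ 2 - (s / 2) ^ 2 = (3 / 4 * s ^ 2) by ring]
    exact le_abs_self _
  rw [hh] at hmax
  simp only [norm_mul, norm_div, ← hsdef] at hmax
  have h3 : (3 * s ^ 2) * (3 / 4 * s ^ 2) / s * ‖E z‖ ≤ 2 * (5 * s ^ 2) * (C * (1 + 2 * s) ^ 2) := by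
    refine le_trans ?_ hmax
    gcongr
  rw [norm_mul, ← hsdef]
  have h4 : (3 * s ^ 2) * (3 / 4 * s ^ 2) / s * ‖E z‖ = s ^ 2 * (9 / 4 * (s * ‖E z‖)) := by
    field_simp
    ring
  rw [h4, show 2 * (5 * s ^ 2) * (C * (1 + 2 * s) ^ 2) = s ^ 2 * (10 * (C * (1 + 2 * s) ^ 2)) by ring]
    at h3
  have h5 := le_of_mul_le_mul_left h3 (by positivity)
  have h6 : 0 ≤ C * (1 + 2 * s) ^ 2 := by positivity
  linarith

theorem differentiable_dslope {f : ℂ → ℂ} (hf : Differentiable ℂ f) (c : ℂ) :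
    Differentiable ℂ (dslope f c) := by
  rw [← differentiableOn_univ] at hf ⊢
  exact (Complex.differentiableOn_dslope univ_mem).2 hf

theorem eq_const_of_linear_growth {S : ℂ → ℂ} {K : ℝ} (hS : Differentiable ℂ S)
    (hK : ∀ z : ℂ, 1 ≤ ‖z‖ → ‖S z‖ ≤ K * ‖z‖)
    (hlim : Tendsto (fun x : ℝ => S x / x) atTop (nhds 0)) (z : ℂ) : S z = S 0 := by
  have hd := differentiable_dslope hS 0
  have hval : ∀ w : ℂ, w ≠ 0 → dslope S 0 w = (S w - S 0) / w := fun w hw => by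
    rw [dslope_of_ne _ hw, slope_def_field, sub_zero]
  have hbdd : Bornology.IsBounded (range (dslope S 0)) := by
    obtain ⟨B, hB⟩ := (isCompact_closedBall (0:ℂ) 1).exists_bound_of_continuousOn
      hd.continuous.continuousOn
    refine isBounded_iff_forall_norm_le.2 ⟨max B (K + ‖S 0‖), ?_⟩
    rintro _ ⟨w, rfl⟩
    rcases le_or_gt ‖w‖ 1 with h | h
    · exact (hB w (by simpa using h)).trans (le_max_left _ _)
    · refine le_trans ?_ (le_max_right _ _)
      have hw : 0 < ‖w‖ := by linarith
      rw [hval w (norm_pos_iff.1 hw), norm_div, div_le_iff₀ hw]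
      have h1 := hK w h.le
      have h2 := norm_sub_le (S w) (S 0)
      have h3 := norm_nonneg (S 0)
      nlinarith
  have hk : ∀ w, dslope S 0 w = dslope S 0 0 := fun w => hd.apply_eq_apply_of_bounded hbdd w 0
  have hk0 : dslope S 0 0 = 0 := by
    have h1 : Tendsto (fun x : ℝ => S x / x - S 0 / x) atTop (nhds (0 - 0)) := by
      refine hlim.sub ?_
      rw [tendsto_zero_iff_norm_tendsto_zero]
      simp only [norm_div, norm_real, Real.norm_eq_abs]
      exact tendsto_const_nhds.div_atTop tendsto_abs_atTop_atTop
    rw [sub_zero] at h1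
    refine tendsto_nhds_unique_of_eventuallyEq tendsto_const_nhds h1 ?_
    filter_upwards [eventually_gt_atTop 0] with x hx
    rw [← hk x, hval x (ofReal_ne_zero.2 hx.ne'), sub_div]
  by_cases hz : z = 0
  · rw [hz]
  · have := (hval z hz).symm.trans ((hk z).trans hk0)
    rw [div_eq_zero_iff] at this
    exact sub_eq_zero.1 (this.resolve_right hz)

theorem exists_const_of_punctured {E : ℂ → ℂ} {C : ℝ} (hE : DifferentiableOn ℂ E {0}ᶜ)
    (hC : ∀ z : ℂ, z.im ≠ 0 → ‖E z‖ ≤ C * (1 + ‖z‖) ^ 2 / |z.im|)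
    (h0 : Tendsto (fun x : ℝ => (x:ℂ) * E x) (nhdsWithin 0 (Ioi 0)) (nhds 0))
    (hinf : Tendsto (fun x : ℝ => E x / x) atTop (nhds 0)) :
    ∃ c : ℂ, ∀ z : ℂ, z ≠ 0 → E z = c := by
  have hb := fun z (hz : z ≠ 0) => norm_mul_le_of_norm_le_div_im hE hC hz
  have hC0 : 0 ≤ C := by
    have := (norm_nonneg _).trans (hC I (by simp))
    simp only [norm_I, I_im, abs_one, div_one] at this
    linarith
  set P : ℂ → ℂ := Function.update (fun z => z * E z) 0
    (limUnder (nhdsWithin 0 {0}ᶜ) fun z => z * E z) with hP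
  have hPd : Differentiable ℂ P := by
    intro z
    by_cases hz : z = 0
    · have := Complex.differentiableOn_update_limUnder_of_bddAbove (f := fun z => z * E z)
        (Metric.ball_mem_nhds (0:ℂ) one_pos) ?_ ?_
      · rw [hz]
        exact this.differentiableAt (Metric.ball_mem_nhds (0:ℂ) one_pos)
      · exact (differentiableOn_id.mul hE).mono fun w hw => hw.2
      · refine ⟨8 * C * 9, ?_⟩
        rintro _ ⟨w, hw, rfl⟩
        refine (hb w hw.2).trans ?_
        have : ‖w‖ < 1 := by simpa using hw.1
        have h2 := norm_nonneg w
        gcongr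
        nlinarith
    · have h1 : DifferentiableAt ℂ (fun z => z * E z) z :=
        differentiableAt_id.mul (hE.differentiableAt (isOpen_compl_singleton.mem_nhds hz))
      refine h1.congr_of_eventuallyEq ?_
      filter_upwards [isOpen_compl_singleton.mem_nhds (show z ∈ ({0}ᶜ : Set ℂ) from hz)] with w hw
      exact Function.update_of_ne hw _ _
  have hPE : ∀ z : ℂ, z ≠ 0 → P z = z * E z := fun z hz => Function.update_of_ne hz _ _
  have hP0 : P 0 = 0 := by
    have h1 : Tendsto (fun x : ℝ => P x) (nhdsWithin 0 (Ioi 0)) (nhds (P ((0:ℝ):ℂ))) := by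
      apply tendsto_nhdsWithin_of_tendsto_nhds
      exact Continuous.tendsto (f := fun x : ℝ => P x)
        (hPd.continuous.comp continuous_ofReal) (0:ℝ)
    have h2 := tendsto_nhds_unique_of_eventuallyEq h1 h0 (by
      filter_upwards [self_mem_nhdsWithin] with x hx
      exact hPE x (ofReal_ne_zero.2 (ne_of_gt hx)))
    simpa using h2
  have hSd := differentiable_dslope hPd 0
  have hSE : ∀ z : ℂ, z ≠ 0 → dslope P 0 z = E z := fun z hz => by
    rw [dslope_of_ne _ hz, slope_def_field, hP0, hPE z hz, sub_zero, sub_zero,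
      mul_div_cancel_left₀ _ hz]
  refine ⟨dslope P 0 0, fun z hz => ?_⟩
  rw [← hSE z hz]
  refine eq_const_of_linear_growth (K := 72 * C) hSd (fun w hw => ?_) ?_ z
  · have hw0 : w ≠ 0 := norm_pos_iff.1 (by linarith)
    have h1 := hb w hw0
    rw [hSE w hw0]
    rw [norm_mul] at h1
    have h2 : 8 * C * (1 + 2 * ‖w‖) ^ 2 ≤ ‖w‖ * (72 * C * ‖w‖) := by
      have : (1 + 2 * ‖w‖) ^ 2 ≤ 9 * ‖w‖ ^ 2 := by nlinarith
      calc _ ≤ 8 * C * (9 * ‖w‖ ^ 2) := by gcongr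
        _ = _ := by ring
    exact le_of_mul_le_mul_left (h1.trans h2) (by linarith)
  · refine hinf.congr' ?_
    filter_upwards [eventually_gt_atTop 0] with x hx
    rw [hSE x (ofReal_ne_zero.2 hx.ne')]

/-- The integral `∫ (1 / (z + t) - 1 / (1 + t)) θ(t) dt` over `(0, ∞)`. -/
noncomputable def logStieltjes (θ : ℝ → ℝ) (z : ℂ) : ℂ :=
  ∫ t in Ioi (0:ℝ), (1 / (z + (t:ℂ)) - 1 / (1 + (t:ℂ))) * (θ t : ℂ)

theorem integrableOn_inv_one_add_sq_Ioi :
    IntegrableOn (fun t : ℝ => ((1 + t) ^ 2)⁻¹) (Ioi 0) := by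
  refine (integrable_inv_one_add_sq.integrableOn (s := Ioi (0:ℝ))).mono' ?_ ?_
  · exact Measurable.aestronglyMeasurable (by fun_prop)
  · refine (ae_restrict_iff' measurableSet_Ioi).2 (Eventually.of_forall fun t ht => ?_)
    have ht : 0 < t := ht
    rw [Real.norm_of_nonneg (by positivity)]
    gcongr
    nlinarith

theorem one_add_ofReal_ne_zero {t : ℝ} (ht : 0 ≤ t) : (1 + (t:ℂ)) ≠ 0 := by
  rw [← ofReal_one, ← ofReal_add, ofReal_ne_zero]
  positivity

theorem norm_stieltjesKernel_le {z : ℂ} {t K r : ℝ} (ht : 0 ≤ t) (hK : 1 + t ≤ K * ‖z + t‖)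
    (hr : ‖z‖ ≤ r) :
    ‖1 / (z + (t:ℂ)) - 1 / (1 + (t:ℂ))‖ ≤ K * (1 + r) * ((1 + t) ^ 2)⁻¹ := by
  have hz0 : z + (t:ℂ) ≠ 0 := fun h => by
    rw [h, norm_zero, mul_zero] at hK; linarith
  have hp : 0 < ‖z + (t:ℂ)‖ := norm_pos_iff.2 hz0
  have hK0 : 0 < K := by
    by_contra hcon
    nlinarith
  rw [div_sub_div _ _ hz0 (one_add_ofReal_ne_zero ht), norm_div, norm_mul,
    show 1 * (1 + (t:ℂ)) - (z + (t:ℂ)) * 1 = 1 - z by ring]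
  have h1 : ‖(1 + (t:ℂ))‖ = 1 + t := by
    rw [← ofReal_one, ← ofReal_add, norm_real, Real.norm_of_nonneg (by positivity)]
  have h2 : ‖1 - z‖ ≤ 1 + r := (norm_sub_le _ _).trans (by rw [norm_one]; linarith)
  rw [h1, div_le_iff₀ (by positivity)]
  have hr0 : 0 ≤ r := (norm_nonneg z).trans hr
  calc ‖1 - z‖ ≤ 1 + r := h2
    _ = (1 + r) * ((1 + t) ^ 2)⁻¹ * (1 + t) * (1 + t) := by field_simp
    _ ≤ (1 + r) * ((1 + t) ^ 2)⁻¹ * (1 + t) * (K * ‖z + t‖) := by gcongr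
    _ = _ := by ring

theorem exists_one_add_le_mul_norm_add {z₀ : ℂ} (hz₀ : z₀ ∈ slitPlane) :
    ∃ r > 0, Metric.ball z₀ r ⊆ slitPlane ∧ ∃ K : ℝ, ∀ z ∈ Metric.ball z₀ r, ∀ t : ℝ, 0 ≤ t →
      1 + t ≤ K * ‖z + t‖ := by
  obtain ⟨R, hR, hball⟩ := Metric.isOpen_iff.1 isOpen_slitPlane z₀ hz₀
  refine ⟨R / 2, by positivity, (Metric.ball_subset_ball (by linarith)).trans hball,
    1 + (‖z₀‖ + R + 1) / (R / 2), fun z hz t ht => ?_⟩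
  rw [mem_ball_iff_norm] at hz
  have h1 : R ≤ ‖z₀ + t‖ := by
    by_contra hcon
    have : (-(t:ℂ)) ∈ slitPlane := hball (by
      rw [mem_ball_iff_norm, norm_sub_rev, sub_neg_eq_add]; linarith)
    rw [← ofReal_neg, ofReal_mem_slitPlane] at this
    linarith
  have h2 : R / 2 ≤ ‖z + t‖ := by
    have : ‖z₀ + t‖ ≤ ‖z + t‖ + ‖z - z₀‖ := by
      rw [show z₀ + (t:ℂ) = (z + t) - (z - z₀) by ring]; exact norm_sub_le _ _
    linarith
  have h3 : t ≤ ‖z + t‖ + (‖z₀‖ + R) := by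
    have e1 : ‖(t:ℂ)‖ ≤ ‖z + t‖ + ‖z‖ := by
      nth_rw 1 [show (t:ℂ) = (z + t) - z by ring]; exact norm_sub_le _ _
    have e2 : ‖z‖ ≤ ‖z₀‖ + ‖z - z₀‖ := by
      nth_rw 1 [show z = z₀ + (z - z₀) by ring]; exact norm_add_le _ _
    rw [norm_real, Real.norm_of_nonneg ht] at e1
    linarith
  have h4 : ‖z₀‖ + R + 1 ≤ (‖z₀‖ + R + 1) / (R / 2) * ‖z + t‖ := by
    rw [div_mul_eq_mul_div, le_div_iff₀ (by positivity)]
    have := norm_nonneg z₀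
    gcongr
  linarith

theorem aestronglyMeasurable_stieltjesKernel {θ : ℝ → ℝ} {μ : Measure ℝ}
    (hm : AEStronglyMeasurable θ μ) (z : ℂ) :
    AEStronglyMeasurable (fun t : ℝ => (1 / (z + (t:ℂ)) - 1 / (1 + (t:ℂ))) * (θ t : ℂ)) μ := by
  refine AEStronglyMeasurable.mul (Measurable.aestronglyMeasurable (by fun_prop)) ?_
  exact continuous_ofReal.comp_aestronglyMeasurable hm

theorem integrableOn_stieltjes {θ : ℝ → ℝ}
    (hm : AEStronglyMeasurable θ (volume.restrict (Ioi 0)))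
    (hθ : ∀ t, 0 < t → θ t ∈ Icc (0:ℝ) 1) {z : ℂ} (hz : z ∈ slitPlane) :
    IntegrableOn (fun t : ℝ => (1 / (z + (t:ℂ)) - 1 / (1 + (t:ℂ))) * (θ t : ℂ)) (Ioi 0) := by
  obtain ⟨r, hr, -, K, hK⟩ := exists_one_add_le_mul_norm_add hz
  refine (integrableOn_inv_one_add_sq_Ioi.const_mul (K * (1 + ‖z‖))).mono'
    (aestronglyMeasurable_stieltjesKernel hm z) ?_
  refine (ae_restrict_iff' measurableSet_Ioi).2 (Eventually.of_forall fun t ht => ?_)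
  have ht : 0 < t := ht
  have h1 := norm_stieltjesKernel_le ht.le (hK z (Metric.mem_ball_self hr) t ht.le) le_rfl
  rw [norm_mul, norm_real, Real.norm_of_nonneg (hθ t ht).1]
  exact (mul_le_of_le_one_right (norm_nonneg _) (hθ t ht).2).trans h1

theorem differentiableAt_logStieltjes {θ : ℝ → ℝ} {z₀ : ℂ} {r K : ℝ} (hr : 0 < r)
    (hm : AEStronglyMeasurable θ (volume.restrict (Ioi 0)))
    (hθ : ∀ t, 0 < t → θ t ∈ Icc (0:ℝ) 1)
    (hK : ∀ z ∈ Metric.ball z₀ r, ∀ t : ℝ, 0 < t → θ t ≠ 0 → 1 + t ≤ K * ‖z + t‖) :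
    DifferentiableAt ℂ (logStieltjes θ) z₀ := by
  refine (hasDerivAt_integral_of_holomorphic (μ := volume.restrict (Ioi (0:ℝ)))
    (f := fun z t => (1 / (z + (t:ℂ)) - 1 / (1 + (t:ℂ))) * (θ t : ℂ)) hr
    (bound := fun t => |K| * (1 + (‖z₀‖ + r)) * ((1 + t) ^ 2)⁻¹) ?_
    (fun z _ => aestronglyMeasurable_stieltjesKernel hm z) ?_
    (integrableOn_inv_one_add_sq_Ioi.const_mul _)).2.differentiableAt
  · refine (ae_restrict_iff' measurableSet_Ioi).2 (Eventually.of_forall fun t ht => ?_)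
    by_cases h0 : θ t = 0
    · simp [h0]
    · refine DifferentiableOn.mul_const (DifferentiableOn.sub_const ?_ _) _
      refine DifferentiableOn.div (by fun_prop) (by fun_prop) fun z hz h => ?_
      have := hK z hz t ht h0
      rw [h, norm_zero, mul_zero] at this
      have ht : 0 < t := ht
      linarith
  · refine (ae_restrict_iff' measurableSet_Ioi).2 (Eventually.of_forall fun t ht z hz => ?_)
    have ht : 0 < t := ht
    by_cases h0 : θ t = 0
    · simp only [h0, ofReal_zero, mul_zero, norm_zero]
      positivity
    rw [mem_ball_iff_norm] at hz
    have e2 : ‖z‖ ≤ ‖z₀‖ + ‖z - z₀‖ := by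
      nth_rw 1 [show z = z₀ + (z - z₀) by ring]; exact norm_add_le _ _
    have h1 := norm_stieltjesKernel_le ht.le (K := |K|) ((hK z (mem_ball_iff_norm.2 hz) t ht h0).trans
      (mul_le_mul_of_nonneg_right (le_abs_self K) (norm_nonneg _))) (e2.trans (by linarith : _ ≤ ‖z₀‖ + r))
    rw [norm_mul, norm_real, Real.norm_of_nonneg (hθ t ht).1]
    exact (mul_le_of_le_one_right (norm_nonneg _) (hθ t ht).2).trans h1

theorem differentiableOn_logStieltjes {θ : ℝ → ℝ}
    (hm : AEStronglyMeasurable θ (volume.restrict (Ioi 0)))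
    (hθ : ∀ t, 0 < t → θ t ∈ Icc (0:ℝ) 1) :
    DifferentiableOn ℂ (logStieltjes θ) slitPlane := fun z hz => by
  obtain ⟨r, hr, -, K, hK⟩ := exists_one_add_le_mul_norm_add hz
  exact (differentiableAt_logStieltjes hr hm hθ
    fun w hw t ht _ => hK w hw t ht.le).differentiableWithinAt

theorem logStieltjes_conj (θ : ℝ → ℝ) (z : ℂ) :
    logStieltjes θ ((starRingEnd ℂ) z) = (starRingEnd ℂ) (logStieltjes θ z) := by
  rw [logStieltjes, logStieltjes, ← integral_conj]
  simp

theorem norm_stieltjesKernel_le_of_large {z : ℂ} {t : ℝ} (ht : 2 * ‖z‖ + 1 < t) :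
    ‖1 / (z + (t:ℂ)) - 1 / (1 + (t:ℂ))‖ ≤ 2 * (1 + ‖z‖) * t ^ (-2 : ℝ) := by
  have hz := norm_nonneg z
  have ht0 : 0 < t := by linarith
  have h1 : t / 2 ≤ ‖z + t‖ := by
    have e1 : ‖(t:ℂ)‖ ≤ ‖z + t‖ + ‖z‖ := by
      nth_rw 1 [show (t:ℂ) = (z + t) - z by ring]; exact norm_sub_le _ _
    rw [norm_real, Real.norm_of_nonneg ht0.le] at e1
    linarith
  have hK : 1 + t ≤ (2 * (1 + t) / t) * ‖z + t‖ := by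
    calc 1 + t = (2 * (1 + t) / t) * (t / 2) := by field_simp
      _ ≤ _ := by gcongr
  refine (norm_stieltjesKernel_le ht0.le hK le_rfl).trans ?_
  rw [Real.rpow_neg ht0.le, show (2:ℝ) = ((2:ℕ):ℝ) by norm_num, Real.rpow_natCast]
  have : 2 * (1 + t) / t * (1 + ‖z‖) * ((1 + t) ^ 2)⁻¹ = 2 * (1 + ‖z‖) * (t * (1 + t))⁻¹ := by
    field_simp
  push_cast
  rw [this]
  gcongr
  nlinarith

theorem neg_re_logStieltjes_le {θ : ℝ → ℝ}
    (hm : AEStronglyMeasurable θ (volume.restrict (Ioi 0)))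
    (hθ : ∀ t, 0 < t → θ t ∈ Icc (0:ℝ) 1) {z : ℂ} (hz : z ∈ slitPlane) {n : ℝ → ℝ}
    (hn : IntegrableOn n (Ioi 0)) (hn0 : ∀ t, 0 < t → 0 ≤ n t)
    (hzn : ∀ t : ℝ, 0 < t → -(1 / (z + (t:ℂ))).re ≤ n t) :
    -(logStieltjes θ z).re ≤ Real.log (2 * ‖z‖ + 2) + 2 + ∫ t in Ioi (0:ℝ), n t := by
  have hz0 := norm_nonneg z
  set T : ℝ := 2 * ‖z‖ + 1 with hT
  have hT0 : 0 < T := by positivity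
  set g₁ : ℝ → ℝ := (Ioc 0 T).indicator fun t => 1 / (1 + t) with hg₁
  set g₂ : ℝ → ℝ := (Ioi T).indicator fun t => 2 * (1 + ‖z‖) * t ^ (-2 : ℝ) with hg₂
  have hcont : ContinuousOn (fun t : ℝ => 1 / (1 + t)) (uIcc 0 T) := by
    rw [uIcc_of_le hT0.le]
    refine ContinuousOn.div (by fun_prop) (by fun_prop) fun t ht => ?_
    have := ht.1
    positivity
  have hi₁ : IntegrableOn g₁ (Ioi 0) := by
    refine Integrable.integrableOn ((integrable_indicator_iff measurableSet_Ioc).2 ?_)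
    exact (intervalIntegrable_iff_integrableOn_Ioc_of_le hT0.le).1 hcont.intervalIntegrable
  have hi₂ : IntegrableOn g₂ (Ioi 0) := by
    refine Integrable.integrableOn ((integrable_indicator_iff measurableSet_Ioi).2 ?_)
    exact (integrableOn_Ioi_rpow_of_lt (by norm_num) hT0).const_mul _
  have hv₁ : ∫ t in Ioi (0:ℝ), g₁ t = Real.log (2 * ‖z‖ + 2) := by
    rw [setIntegral_indicator measurableSet_Ioc,
      inter_eq_right.2 (Ioc_subset_Ioi_self : Ioc 0 T ⊆ Ioi 0),
      ← intervalIntegral.integral_of_le hT0.le,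
      intervalIntegral.integral_eq_sub_of_hasDerivAt (f := fun t => Real.log (1 + t)) ?_
        hcont.intervalIntegrable]
    · rw [add_zero, Real.log_one, sub_zero, hT]; congr 1; ring
    · intro t ht
      rw [uIcc_of_le hT0.le] at ht
      exact ((hasDerivAt_id t).const_add 1).log (by have := ht.1; simp only [id]; positivity)
  have hv₂ : ∫ t in Ioi (0:ℝ), g₂ t ≤ 2 := by
    rw [setIntegral_indicator measurableSet_Ioi, inter_eq_right.2 (Ioi_subset_Ioi hT0.le),
      integral_const_mul, integral_Ioi_rpow_of_lt (by norm_num) hT0]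
    norm_num
    rw [Real.rpow_neg_one, ← div_eq_mul_inv, div_le_iff₀ hT0, hT]
    linarith
  have hinteg := integrableOn_stieltjes hm hθ hz
  have hre : (logStieltjes θ z).re =
      ∫ t in Ioi (0:ℝ), ((1 / (z + (t:ℂ)) - 1 / (1 + (t:ℂ))) * (θ t : ℂ)).re :=
    (integral_re hinteg).symm
  rw [hre, ← integral_neg]
  calc _ ≤ ∫ t in Ioi (0:ℝ), (g₁ t + g₂ t + n t) := by
        refine setIntegral_mono_on (hinteg.re.neg) ((hi₁.add hi₂).add hn) measurableSet_Ioi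
          fun t ht => ?_
        have ht : 0 < t := ht
        obtain ⟨hθ0, hθ1⟩ := hθ t ht
        rw [re_mul_ofReal]
        rcases le_or_gt t T with h | h
        · have e1 : g₁ t = 1 / (1 + t) := indicator_of_mem (mem_Ioc.2 ⟨ht, h⟩) _
          have e2 : g₂ t = 0 := indicator_of_notMem (fun hh => absurd hh (not_lt.2 h)) _
          rw [e1, e2, sub_re]
          have e3 : (1 / (1 + (t:ℂ))).re = 1 / (1 + t) := by
            rw [← ofReal_one, ← ofReal_add, ← ofReal_div, ofReal_re]
          have h1 : 0 ≤ 1 / (1 + t) := by positivity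
          have h2 := hzn t ht
          have h3 := hn0 t ht
          rw [e3]
          nlinarith
        · have e1 : g₁ t = 0 := indicator_of_notMem (fun hh => absurd hh.2 (not_le.2 h)) _
          have e2 : g₂ t = 2 * (1 + ‖z‖) * t ^ (-2 : ℝ) := indicator_of_mem h _
          have h1 := norm_stieltjesKernel_le_of_large h
          have h2 := (neg_le_abs _).trans ((abs_re_le_norm _).trans h1)
          have h3 := hn0 t ht
          have h4 : 0 ≤ 2 * (1 + ‖z‖) * t ^ (-2 : ℝ) := by positivity
          rw [e1, e2]
          nlinarith
    _ = (∫ t in Ioi (0:ℝ), g₁ t) + (∫ t in Ioi (0:ℝ), g₂ t) + ∫ t in Ioi (0:ℝ), n t := by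
        have hi₁₂ : IntegrableOn (fun t => g₁ t + g₂ t) (Ioi 0) := hi₁.add hi₂
        rw [integral_add hi₁₂ hn, integral_add hi₁ hi₂]
    _ ≤ _ := by rw [hv₁]; linarith

theorem exp_neg_re_logStieltjes_le {θ : ℝ → ℝ}
    (hm : AEStronglyMeasurable θ (volume.restrict (Ioi 0)))
    (hθ : ∀ t, 0 < t → θ t ∈ Icc (0:ℝ) 1) {z : ℂ} (hz : 0 < z.re) :
    Real.exp (-(logStieltjes θ z).re) ≤ Real.exp 2 * (2 * ‖z‖ + 2) := by
  have h := neg_re_logStieltjes_le hm hθ (mem_slitPlane_iff.2 (Or.inl hz)) (n := fun _ => 0)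
    integrableOn_zero (fun _ _ => le_rfl) fun t ht => by
      rw [one_div, inv_re, neg_nonpos]
      refine div_nonneg ?_ (normSq_nonneg _)
      simp only [add_re, ofReal_re]
      linarith
  rw [integral_zero, add_zero] at h
  calc _ ≤ Real.exp (Real.log (2 * ‖z‖ + 2) + 2) := Real.exp_le_exp.2 h
    _ = _ := by rw [Real.exp_add, Real.exp_log (by positivity), mul_comm]

theorem integral_sub_div_sq_add_sq {m y : ℝ} (hy : y ≠ 0) :
    ∫ t in (0:ℝ)..m, (m - t) / ((m - t) ^ 2 + y ^ 2) =
      1 / 2 * Real.log (m ^ 2 + y ^ 2) - 1 / 2 * Real.log (y ^ 2) := by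
  have hpos : ∀ t : ℝ, 0 < (m - t) ^ 2 + y ^ 2 := fun t => by positivity
  have hder : ∀ t, HasDerivAt (fun t => -(1 / 2) * Real.log ((m - t) ^ 2 + y ^ 2))
      ((m - t) / ((m - t) ^ 2 + y ^ 2)) t := fun t => by
    have h1 : HasDerivAt (fun t => (m - t) ^ 2 + y ^ 2) (-(2 * (m - t))) t := by
      have := ((((hasDerivAt_id t).const_sub m).pow 2).add_const (y ^ 2))
      refine this.congr_deriv ?_
      simp
    refine ((h1.log (hpos t).ne').const_mul (-(1 / 2))).congr_deriv ?_
    ring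
  have hcont : Continuous fun t : ℝ => (m - t) / ((m - t) ^ 2 + y ^ 2) :=
    Continuous.div (by fun_prop) (by fun_prop) fun t => (hpos t).ne'
  rw [intervalIntegral.integral_eq_sub_of_hasDerivAt (fun t _ => hder t)
    (hcont.intervalIntegrable _ _)]
  simp only [sub_self, sub_zero]
  ring_nf

theorem exp_neg_re_logStieltjes_mul_le {θ : ℝ → ℝ}
    (hm : AEStronglyMeasurable θ (volume.restrict (Ioi 0)))
    (hθ : ∀ t, 0 < t → θ t ∈ Icc (0:ℝ) 1) {z : ℂ} (hz : z.im ≠ 0) :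
    Real.exp (-(logStieltjes θ z).re) ≤ Real.exp 2 * (2 * ‖z‖ + 2) * (‖z‖ / |z.im|) := by
  have him : 0 < |z.im| := abs_pos.2 hz
  have hle : |z.im| ≤ ‖z‖ := abs_im_le_norm z
  set m : ℝ := max (-z.re) 0 with hmdef
  have hm0 : 0 ≤ m := le_max_right _ _
  have hpos : ∀ t : ℝ, 0 < (m - t) ^ 2 + z.im ^ 2 := fun t => by positivity
  have hcont : Continuous fun t : ℝ => (m - t) / ((m - t) ^ 2 + z.im ^ 2) :=
    Continuous.div (by fun_prop) (by fun_prop) fun t => (hpos t).ne'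
  set n : ℝ → ℝ := (Ioc 0 m).indicator fun t => (m - t) / ((m - t) ^ 2 + z.im ^ 2) with hndef
  have hn0 : ∀ t, 0 ≤ n t := fun t => by
    refine indicator_nonneg (fun s hs => div_nonneg (by linarith [hs.2]) (hpos s).le) t
  have hmle : m ^ 2 ≤ z.re ^ 2 := by
    rcases le_total (-z.re) 0 with h | h
    · rw [hmdef, max_eq_right h, zero_pow two_ne_zero]; positivity
    · rw [hmdef, max_eq_left h]; nlinarith
  have h := neg_re_logStieltjes_le hm hθ (mem_slitPlane_iff.2 (Or.inr hz)) (n := n)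
    (Integrable.integrableOn ((integrable_indicator_iff measurableSet_Ioc).2
      ((intervalIntegrable_iff_integrableOn_Ioc_of_le hm0).1 (hcont.intervalIntegrable _ _))))
    (fun t _ => hn0 t) (fun t ht => by
      by_cases htm : t ≤ m
      · have hmr : m = -z.re := by
          rcases le_total (-z.re) 0 with h | h
          · rw [hmdef, max_eq_right h] at htm; linarith
          · exact max_eq_left h
        have e : n t = (m - t) / ((m - t) ^ 2 + z.im ^ 2) := indicator_of_mem (mem_Ioc.2 ⟨ht, htm⟩) _
        rw [e, one_div, inv_re, normSq_apply, hmr]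
        simp only [add_re, ofReal_re, add_im, ofReal_im, add_zero]
        rw [← neg_div]
        apply le_of_eq
        congr 1 <;> ring
      · refine le_trans ?_ (hn0 t)
        rw [one_div, inv_re, neg_nonpos]
        refine div_nonneg ?_ (normSq_nonneg _)
        simp only [add_re, ofReal_re]
        have := le_max_left (-z.re) 0
        linarith)
  rw [hndef, setIntegral_indicator measurableSet_Ioc,
    inter_eq_right.2 (Ioc_subset_Ioi_self : Ioc 0 m ⊆ Ioi 0),
    ← intervalIntegral.integral_of_le hm0, integral_sub_div_sq_add_sq hz] at h
  have h1 : Real.log (m ^ 2 + z.im ^ 2) ≤ 2 * Real.log ‖z‖ := by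
    rw [← Real.log_rpow (him.trans_le hle)]
    apply Real.log_le_log (by positivity)
    rw [Real.rpow_two, ← normSq_eq_norm_sq, normSq_apply]
    nlinarith
  have h2 : Real.log (z.im ^ 2) = 2 * Real.log |z.im| := by
    rw [← sq_abs, Real.log_pow]; norm_num
  have hz0 : 0 < ‖z‖ := him.trans_le hle
  calc _ ≤ Real.exp (Real.log (2 * ‖z‖ + 2) + 2 + (Real.log ‖z‖ - Real.log |z.im|)) :=
        Real.exp_le_exp.2 (by linarith)
    _ = _ := by
        rw [Real.exp_add, Real.exp_add, Real.exp_sub, Real.exp_log (by positivity),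
          Real.exp_log hz0, Real.exp_log him, mul_comm (Real.exp 2)]

theorem dslope_comm {f : ℂ → ℂ} (a b : ℂ) : dslope f a b = dslope f b a := by
  rcases eq_or_ne a b with rfl | h
  · rfl
  · rw [dslope_of_ne _ h.symm, dslope_of_ne _ h, slope_comm]

theorem exists_norm_dslope_le {f : ℂ → ℂ} {c : ℂ} {r R : ℝ} (hrR : r < R)
    (hf : DifferentiableOn ℂ f (Metric.ball c R)) :
    ∃ B, ∀ z ∈ Metric.closedBall c r, ∀ w ∈ Metric.closedBall c r, ‖dslope f w z‖ ≤ B := by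
  have hsub : Metric.closedBall c r ⊆ Metric.ball c R := Metric.closedBall_subset_ball hrR
  obtain ⟨B, hB⟩ := (isCompact_closedBall c r).exists_bound_of_continuousOn
    ((hf.deriv Metric.isOpen_ball).continuousOn.mono hsub)
  refine ⟨B, fun z hz w hw => ?_⟩
  rcases eq_or_ne z w with rfl | h
  · rw [dslope_same]; exact hB z hz
  · rw [dslope_of_ne _ h, slope_def_field, norm_div,
      div_le_iff₀ (norm_pos_iff.2 (sub_ne_zero.2 h))]
    exact (convex_closedBall c r).norm_image_sub_le_of_norm_deriv_le
      (fun x hx => (hf x (hsub hx)).differentiableAt (Metric.isOpen_ball.mem_nhds (hsub hx)))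
      hB hw hz

theorem integral_one_div_add_of_im_ne_zero {z : ℂ} (hz : z.im ≠ 0) (c d : ℝ) :
    ∫ t in c..d, 1 / (z + (t:ℂ)) = log (z + d) - log (z + c) := by
  have hmem : ∀ t : ℝ, z + t ∈ slitPlane := fun t => Or.inr (by simpa using hz)
  refine intervalIntegral.integral_eq_sub_of_hasDerivAt (f := fun t : ℝ => log (z + t))
    (fun t _ => ?_) ?_
  · exact ((ofRealCLM.hasDerivAt (x := t)).const_add z).clog_real (hmem t)
  · refine Continuous.intervalIntegrable ?_ _ _
    exact Continuous.div (by fun_prop) (by fun_prop) fun t => slitPlane_ne_zero (hmem t)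

theorem log_neg_eq_of_im_pos {z : ℂ} (hz : 0 < z.im) : log z = log (-z) + Real.pi * I := by
  rw [log, log, norm_neg, arg_neg_eq_arg_sub_pi_of_im_pos hz]
  push_cast
  ring

theorem log_neg_eq_of_im_neg {z : ℂ} (hz : z.im < 0) : log z = log (-z) - Real.pi * I := by
  rw [log, log, norm_neg, arg_neg_eq_arg_add_pi_of_im_neg hz]
  push_cast
  ring

theorem logStieltjes_indicator_compl_add {θ : ℝ → ℝ}
    (hm : AEStronglyMeasurable θ (volume.restrict (Ioi 0)))
    (hθ : ∀ t, 0 < t → θ t ∈ Icc (0:ℝ) 1) {z : ℂ} (hz : z ∈ slitPlane) {c d : ℝ}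
    (hc : 0 ≤ c) (hcd : c ≤ d) :
    logStieltjes θ z = logStieltjes ((Ioc c d)ᶜ.indicator θ) z +
      ∫ t in c..d, (1 / (z + (t:ℂ)) - 1 / (1 + (t:ℂ))) * (θ t : ℂ) := by
  have hsub : Ioc c d ⊆ Ioi 0 := fun t ht => lt_of_le_of_lt hc ht.1
  have hinteg := integrableOn_stieltjes hm hθ hz
  rw [intervalIntegral.integral_of_le hcd, logStieltjes, logStieltjes,
    ← inter_eq_right.2 hsub, ← setIntegral_indicator measurableSet_Ioc, inter_eq_right.2 hsub]
  have hfun : ∀ t : ℝ, (1 / (z + (t:ℂ)) - 1 / (1 + (t:ℂ))) * (((Ioc c d)ᶜ.indicator θ t : ℝ) : ℂ) =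
      (Ioc c d)ᶜ.indicator (fun t : ℝ => (1 / (z + (t:ℂ)) - 1 / (1 + (t:ℂ))) * (θ t : ℂ)) t := by
    intro t
    by_cases h : t ∈ (Ioc c d)ᶜ <;> simp [h]
  simp_rw [hfun]
  rw [← integral_add (hinteg.indicator measurableSet_Ioc.compl) (hinteg.indicator measurableSet_Ioc)]
  congr 1
  ext t
  exact (congrFun (indicator_compl_add_self (Ioc c d)
    fun t : ℝ => (1 / (z + (t:ℂ)) - 1 / (1 + (t:ℂ))) * (θ t : ℂ)) t).symm

theorem differentiableAt_logStieltjes_indicator_compl {θ : ℝ → ℝ}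
    (hm : AEStronglyMeasurable θ (volume.restrict (Ioi 0)))
    (hθ : ∀ t, 0 < t → θ t ∈ Icc (0:ℝ) 1) {q R : ℝ} (hR : 0 < R) (hq : 0 ≤ q) {z : ℂ}
    (hz : z ∈ Metric.ball (-(q:ℂ)) (R / 4)) :
    DifferentiableAt ℂ (logStieltjes ((Ioc (q - R / 2) (q + R / 2))ᶜ.indicator θ)) z := by
  obtain ⟨r, hr, hball⟩ := Metric.isOpen_iff.1 Metric.isOpen_ball z hz
  refine differentiableAt_logStieltjes (K := 2 + (1 + q) * (4 / R)) hr
    (hm.indicator measurableSet_Ioc.compl) (fun t ht => ?_) fun w hw t _ h0 => ?_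
  · by_cases h : t ∈ (Ioc (q - R / 2) (q + R / 2))ᶜ
    · rw [indicator_of_mem h]; exact hθ t ht
    · rw [indicator_of_notMem h]; exact ⟨le_rfl, zero_le_one⟩
  · have htm : t ∉ Ioc (q - R / 2) (q + R / 2) := mem_of_indicator_ne_zero h0
    have h1 : R / 2 ≤ |t - q| := by
      by_contra hcon
      obtain ⟨h2, h3⟩ := abs_lt.1 (not_le.1 hcon)
      exact htm ⟨by linarith, by linarith⟩
    have hw' : ‖w + q‖ < R / 4 := by
      rw [← sub_neg_eq_add]; exact mem_ball_iff_norm.1 (hball hw)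
    have h2 : |t - q| ≤ ‖w + t‖ + ‖w + q‖ := by
      rw [← Real.norm_eq_abs, ← norm_real, ofReal_sub, show (t:ℂ) - q = (w + t) - (w + q) by ring]
      exact norm_sub_le _ _
    have h3 : 1 ≤ 4 / R * ‖w + t‖ := by
      rw [div_mul_eq_mul_div, le_div_iff₀ hR]; linarith
    have h4 : 1 + q ≤ (1 + q) * (4 / R * ‖w + t‖) := le_mul_of_one_le_right (by linarith) h3
    have h5 := le_abs_self (t - q)
    nlinarith

/-- If the density `θ` extends holomorphically near `q > 0`, then both branches of its logarithmic
Stieltjes transform extend holomorphically across the cut near `-q`, with jump `2πiθ`. -/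
theorem exists_logStieltjes_eq_of_holomorphic {θ : ℝ → ℝ}
    (hm : AEStronglyMeasurable θ (volume.restrict (Ioi 0)))
    (hθ : ∀ t, 0 < t → θ t ∈ Icc (0:ℝ) 1) {q R : ℝ} (hR : 0 < R) (hRq : R ≤ q) {Θ : ℂ → ℂ}
    (hΘ : DifferentiableOn ℂ Θ (Metric.ball (-(q:ℂ)) R))
    (hΘθ : ∀ t : ℝ, |t - q| < R → Θ (-(t:ℂ)) = θ t) :
    ∃ M : ℂ → ℂ, DifferentiableOn ℂ M (Metric.ball (-(q:ℂ)) (R / 4)) ∧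
      (∀ z ∈ Metric.ball (-(q:ℂ)) (R / 4), 0 < z.im →
        logStieltjes θ z = M z - Real.pi * I * Θ z) ∧
      (∀ z ∈ Metric.ball (-(q:ℂ)) (R / 4), z.im < 0 →
        logStieltjes θ z = M z + Real.pi * I * Θ z) := by
  set c := q - R / 2 with hc
  set d := q + R / 2 with hd
  have hcd : c ≤ d := by linarith
  have hsub : Metric.ball (-(q:ℂ)) (R / 4) ⊆ Metric.ball (-(q:ℂ)) R :=
    Metric.ball_subset_ball (by linarith)
  have hsub' : Metric.ball (-(q:ℂ)) (R / 4) ⊆ Metric.closedBall (-(q:ℂ)) (R / 2) :=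
    Metric.ball_subset_closedBall.trans (Metric.closedBall_subset_closedBall (by linarith))
  have hmem : ∀ t ∈ Icc c d, -(t:ℂ) ∈ Metric.closedBall (-(q:ℂ)) (R / 2) := fun t ht => by
    rw [mem_closedBall_iff_norm, show -(t:ℂ) - -(q:ℂ) = ((q - t : ℝ) : ℂ) by push_cast; ring,
      norm_real, Real.norm_eq_abs, abs_le]
    exact ⟨by linarith [ht.2], by linarith [ht.1]⟩
  have hmem' : ∀ t ∈ Icc c d, -(t:ℂ) ∈ Metric.ball (-(q:ℂ)) R := fun t ht =>
    Metric.closedBall_subset_ball (by linarith) (hmem t ht)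
  obtain ⟨B, hB⟩ := exists_norm_dslope_le (by linarith : R / 2 < R) hΘ
  have hneg : ContinuousOn (fun t : ℝ => -(t:ℂ)) (Icc c d) := by fun_prop
  have hcont : ∀ z ∈ Metric.ball (-(q:ℂ)) (R / 4),
      ContinuousOn (fun t : ℝ => dslope Θ (-(t:ℂ)) z) (Icc c d) := fun z hz => by
    have h1 : ContinuousOn (dslope Θ z) (Metric.ball (-(q:ℂ)) R) :=
      ((Complex.differentiableOn_dslope (Metric.isOpen_ball.mem_nhds (hsub hz))).2 hΘ).continuousOn
    exact (h1.comp hneg fun t ht => hmem' t ht).congr fun t _ => dslope_comm _ _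
  have hΘc : ContinuousOn (fun t : ℝ => Θ (-(t:ℂ))) (Icc c d) :=
    hΘ.continuousOn.comp hneg fun t ht => hmem' t ht
  set D : ℂ → ℂ := fun z => ∫ t in c..d, dslope Θ (-(t:ℂ)) z with hD
  have hDd : DifferentiableOn ℂ D (Metric.ball (-(q:ℂ)) (R / 4)) := fun z hz => by
    obtain ⟨r, hr, hball⟩ := Metric.isOpen_iff.1 Metric.isOpen_ball z hz
    have h1 : D = fun z => ∫ t in Ioc c d, dslope Θ (-(t:ℂ)) z := by
      ext w; exact intervalIntegral.integral_of_le hcd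
    rw [h1]
    refine (hasDerivAt_integral_of_holomorphic (μ := volume.restrict (Ioc c d))
      (f := fun z t => dslope Θ (-(t:ℂ)) z) hr (bound := fun _ => B) ?_ (fun w hw => ?_) ?_
      (integrable_const B)).2.differentiableAt.differentiableWithinAt
    · refine (ae_restrict_iff' measurableSet_Ioc).2 (Eventually.of_forall fun t ht => ?_)
      exact ((Complex.differentiableOn_dslope (Metric.isOpen_ball.mem_nhds
        (hmem' t (Ioc_subset_Icc_self ht)))).2 hΘ).mono (hball.trans hsub)
    · exact ((hcont w (hball hw)).mono Ioc_subset_Icc_self).aestronglyMeasurable measurableSet_Ioc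
    · refine (ae_restrict_iff' measurableSet_Ioc).2 (Eventually.of_forall fun t ht w hw => ?_)
      exact hB w (hsub' (hball hw)) _ (hmem t (Ioc_subset_Icc_self ht))
  set k : ℂ := ∫ t in c..d, Θ (-(t:ℂ)) / (1 + (t:ℂ)) with hk
  have hkc : ContinuousOn (fun t : ℝ => Θ (-(t:ℂ)) / (1 + (t:ℂ))) (Icc c d) :=
    hΘc.div (by fun_prop) fun t ht => one_add_ofReal_ne_zero (by linarith [ht.1])
  have hre : ∀ z ∈ Metric.ball (-(q:ℂ)) (R / 4), |z.re + q| < R / 4 := fun z hz => by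
    rw [mem_ball_iff_norm, sub_neg_eq_add] at hz
    have := (abs_re_le_norm (z + q)).trans_lt hz
    simpa using this
  have hzd : ∀ z ∈ Metric.ball (-(q:ℂ)) (R / 4), z + d ∈ slitPlane := fun z hz => Or.inl (by
    have := (abs_lt.1 (hre z hz)).1
    simp only [add_re, ofReal_re]; linarith)
  have hzc : ∀ z ∈ Metric.ball (-(q:ℂ)) (R / 4), -(z + c) ∈ slitPlane := fun z hz => Or.inl (by
    have := (abs_lt.1 (hre z hz)).2
    simp only [neg_re, add_re, ofReal_re]; linarith)
  have hloc : ∀ z ∈ Metric.ball (-(q:ℂ)) (R / 4), z.im ≠ 0 →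
      ∫ t in c..d, (1 / (z + (t:ℂ)) - 1 / (1 + (t:ℂ))) * (θ t : ℂ) =
        -D z + Θ z * (log (z + d) - log (z + c)) - k := fun z hz him => by
    have hne : ∀ t : ℝ, z + t ≠ 0 := fun t h => him (by simpa using congrArg im h)
    rw [← integral_one_div_add_of_im_ne_zero him, hD, hk, ← intervalIntegral.integral_neg,
      ← intervalIntegral.integral_const_mul, ← intervalIntegral.integral_add,
      ← intervalIntegral.integral_sub]
    · refine intervalIntegral.integral_congr fun t ht => ?_
      rw [uIcc_of_le hcd] at ht
      have h1 : (θ t : ℂ) = Θ (-(t:ℂ)) := (hΘθ t (by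
        rw [abs_lt]; exact ⟨by linarith [ht.1], by linarith [ht.2]⟩)).symm
      have h2 : z ≠ -(t:ℂ) := fun h => hne t (by rw [h]; ring)
      have h3 := hne t
      have h4 : (1 + (t:ℂ)) ≠ 0 := one_add_ofReal_ne_zero (by linarith [ht.1])
      simp only [h1]
      rw [dslope_of_ne _ h2, slope_def_field, sub_neg_eq_add]
      field_simp
      ring
    · refine ContinuousOn.intervalIntegrable ?_
      rw [uIcc_of_le hcd]
      exact (hcont z hz).neg.add (continuousOn_const.mul
        (ContinuousOn.div (by fun_prop) (by fun_prop) fun t _ => hne t))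
    · refine ContinuousOn.intervalIntegrable ?_
      rwa [uIcc_of_le hcd]
    · refine ContinuousOn.intervalIntegrable ?_
      rw [uIcc_of_le hcd]
      exact (hcont z hz).neg
    · refine ContinuousOn.intervalIntegrable ?_
      exact continuousOn_const.mul
        (ContinuousOn.div (by fun_prop) (by fun_prop) fun t _ => hne t)
  refine ⟨fun z => logStieltjes ((Ioc c d)ᶜ.indicator θ) z +
    (-D z + Θ z * (log (z + d) - log (-(z + c))) - k), fun z hz => ?_, fun z hz him => ?_,
    fun z hz him => ?_⟩
  · have hΘz : DifferentiableWithinAt ℂ Θ (Metric.ball (-(q:ℂ)) (R / 4)) z := hΘ.mono hsub z hz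
    have hl : DifferentiableAt ℂ (fun z : ℂ => log (z + d) - log (-(z + c))) z :=
      ((differentiableAt_id.add_const _).clog (hzd z hz)).sub
        (((differentiableAt_id.add_const _).neg).clog (hzc z hz))
    exact (differentiableAt_logStieltjes_indicator_compl hm hθ hR (hR.le.trans hRq)
      hz).differentiableWithinAt.add (((hDd z hz).neg.add
        (hΘz.mul hl.differentiableWithinAt)).sub_const _)
  · rw [logStieltjes_indicator_compl_add hm hθ (Or.inr him.ne') (by linarith) hcd,
      hloc z hz him.ne', log_neg_eq_of_im_pos (z := z + c) (by simpa using him)]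
    ring
  · rw [logStieltjes_indicator_compl_add hm hθ (Or.inr him.ne) (by linarith) hcd,
      hloc z hz him.ne, log_neg_eq_of_im_neg (z := z + c) (by simpa using him)]
    ring

/-- A function holomorphic on the slit plane whose two branches across the negative axis have
common local holomorphic extensions extends holomorphically to the punctured plane. -/
theorem exists_differentiableOn_compl_zero_of_local {Q : ℂ → ℂ}
    (hQ : DifferentiableOn ℂ Q slitPlane)
    (hloc : ∀ q : ℝ, 0 < q → ∃ r > 0, ∃ H : ℂ → ℂ,
      DifferentiableOn ℂ H (Metric.ball (-(q:ℂ)) r) ∧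
      ∀ z ∈ Metric.ball (-(q:ℂ)) r, z.im ≠ 0 → Q z = H z) :
    ∃ E : ℂ → ℂ, DifferentiableOn ℂ E {0}ᶜ ∧ EqOn E Q slitPlane := by
  set E : ℂ → ℂ := fun z => limUnder (nhdsWithin (0:ℝ) (Ioi 0)) fun ε => Q (z + ε * I) with hE
  have key : ∀ (F : ℂ → ℂ) (U : Set ℂ), IsOpen U → ContinuousOn F U →
      (∀ z ∈ U, z.im ≠ 0 → Q z = F z) → ∀ z ∈ U, E z = F z := fun F U hU hF hQF z hz => by
    have hlim : Tendsto (fun ε : ℝ => z + ε * I) (nhdsWithin (0:ℝ) (Ioi 0)) (nhds z) := by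
      have : Continuous fun ε : ℝ => z + ε * I := by fun_prop
      simpa using (this.tendsto 0).mono_left nhdsWithin_le_nhds
    have him : ∀ᶠ ε : ℝ in nhdsWithin (0:ℝ) (Ioi 0), z.im + ε ≠ 0 := by
      rcases le_or_gt 0 z.im with h | h
      · filter_upwards [self_mem_nhdsWithin] with ε (hε : 0 < ε)
        linarith
      · filter_upwards [mem_nhdsWithin_of_mem_nhds (Iio_mem_nhds (neg_pos.2 h))] with ε (hε : ε < _)
        linarith
    refine Tendsto.limUnder_eq ?_
    refine (((hF z hz).continuousAt (hU.mem_nhds hz)).tendsto.comp hlim).congr' ?_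
    filter_upwards [him, hlim.eventually (hU.mem_nhds hz)] with ε h1 h2
    exact (hQF _ h2 (by simpa using h1)).symm
  have hEQ : EqOn E Q slitPlane :=
    key Q slitPlane isOpen_slitPlane hQ.continuousOn fun _ _ _ => rfl
  refine ⟨E, fun z hz => DifferentiableAt.differentiableWithinAt ?_, hEQ⟩
  by_cases hs : z ∈ slitPlane
  · exact ((hQ z hs).differentiableAt (isOpen_slitPlane.mem_nhds hs)).congr_of_eventuallyEq
      (hEQ.eventuallyEq_of_mem (isOpen_slitPlane.mem_nhds hs))
  · rw [mem_slitPlane_iff, not_or, not_lt, not_not] at hs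
    have hre : 0 < -z.re := by
      rcases hs.1.lt_or_eq with h | h
      · linarith
      · exact absurd (Complex.ext h hs.2) hz
    obtain ⟨r, hr, H, hH, hQH⟩ := hloc (-z.re) hre
    have hzq : -((-z.re : ℝ) : ℂ) = z := by apply Complex.ext <;> simp [hs.2]
    rw [hzq] at hH hQH
    have hnhds := Metric.ball_mem_nhds z hr
    exact ((hH z (Metric.mem_ball_self hr)).differentiableAt hnhds).congr_of_eventuallyEq
      (EqOn.eventuallyEq_of_mem (key H _ Metric.isOpen_ball hH.continuousOn hQH) hnhds)

theorem thetaFun_mem_Icc {α t : ℝ} (hα : α ∈ Ioo (0:ℝ) 1) (ht : 0 < t) :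
    thetaFun α t ∈ Icc (0:ℝ) 1 := by
  have h1 : (GalphaPlus α t).arg < 0 := arg_neg_iff.2 (GalphaPlus_im_neg hα ht)
  have h2 := neg_pi_lt_arg (GalphaPlus α t)
  rw [thetaFun]
  exact ⟨div_nonneg (by linarith) Real.pi_pos.le, (div_le_one Real.pi_pos).2 (by linarith)⟩

theorem aestronglyMeasurable_thetaFun {α : ℝ} (hα : α ∈ Ioo (0:ℝ) 1) :
    AEStronglyMeasurable (thetaFun α) (volume.restrict (Ioi 0)) := by
  refine ContinuousOn.aestronglyMeasurable (fun t ht => ?_) measurableSet_Ioi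
  have ht : 0 < t := ht
  have h1 : ContinuousAt (fun t : ℝ => GalphaPlus α t) t := by
    have h2 : ContinuousAt (GalphaUp α) (-(t:ℂ)) :=
      (differentiableAt_GalphaUp hα (by simpa using ht)).continuousAt
    simp only [GalphaPlus_eq hα]
    exact ContinuousAt.comp (f := fun t : ℝ => -(t:ℂ)) h2 (by fun_prop)
  have h3 : ContinuousAt arg (GalphaPlus α t) :=
    continuousAt_arg (Or.inr (GalphaPlus_im_neg hα ht).ne)
  exact ((ContinuousAt.comp (f := fun t : ℝ => GalphaPlus α t) h3 h1).neg.div_const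
    _).continuousWithinAt

/-- The quotient of `Galpha α` by its claimed product form, up to the constant. -/
noncomputable def GalphaRatio (α : ℝ) (z : ℂ) : ℂ :=
  Galpha α z * exp (expRate α * z) * exp (-logStieltjes (thetaFun α) z)

theorem exists_GalphaRatio_extension {α q : ℝ} (hα : α ∈ Ioo (0:ℝ) 1) (hq : 0 < q) :
    ∃ r > 0, ∃ H : ℂ → ℂ, DifferentiableOn ℂ H (Metric.ball (-(q:ℂ)) r) ∧
      ∀ z ∈ Metric.ball (-(q:ℂ)) r, z.im ≠ 0 → GalphaRatio α z = H z := by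
  have hcont : ContinuousAt (GalphaUp α) (-(q:ℂ)) :=
    (differentiableAt_GalphaUp hα (by simpa using hq)).continuousAt
  have him : (GalphaUp α (-(q:ℂ))).im < 0 := GalphaPlus_eq hα (r := q) ▸ GalphaPlus_im_neg hα hq
  obtain ⟨R₀, hR₀, hR₀im⟩ := Metric.eventually_nhds_iff_ball.1
    ((continuous_im.continuousAt.comp hcont).eventually_lt_const him)
  obtain ⟨R, hR, hRR₀, hRq⟩ : ∃ R > 0, R ≤ R₀ ∧ R ≤ q :=
    ⟨min R₀ q, lt_min hR₀ hq, min_le_left _ _, min_le_right _ _⟩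
  have hUim : ∀ z ∈ Metric.ball (-(q:ℂ)) R, (GalphaUp α z).im < 0 := fun z hz =>
    hR₀im z (Metric.ball_subset_ball hRR₀ hz)
  have hre : ∀ z ∈ Metric.ball (-(q:ℂ)) R, z.re < 0 := fun z hz => by
    rw [mem_ball_iff_norm, sub_neg_eq_add] at hz
    have := (abs_lt.1 ((abs_re_le_norm (z + q)).trans_lt hz)).2
    simp only [add_re, ofReal_re] at this
    linarith
  have hconj : ∀ z ∈ Metric.ball (-(q:ℂ)) R, (starRingEnd ℂ) z ∈ Metric.ball (-(q:ℂ)) R :=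
    fun z hz => by
      rw [Metric.mem_ball] at hz ⊢
      rwa [← dist_conj_conj, conj_conj, map_neg, conj_ofReal]
  set l : ℂ → ℂ := fun z => log (GalphaUp α z) with hl
  set l' : ℂ → ℂ := (starRingEnd ℂ) ∘ l ∘ (starRingEnd ℂ) with hl'
  have hexpl : ∀ z ∈ Metric.ball (-(q:ℂ)) R, exp (l z) = GalphaUp α z := fun z hz =>
    exp_log fun h => by simpa [h] using hUim z hz
  have hld : ∀ z ∈ Metric.ball (-(q:ℂ)) R, DifferentiableAt ℂ l z := fun z hz =>
    (differentiableAt_GalphaUp hα (hre z hz)).clog (Or.inr (hUim z hz).ne)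
  have hld' : ∀ z ∈ Metric.ball (-(q:ℂ)) R, DifferentiableAt ℂ l' z := fun z hz => by
    rw [hl', differentiableAt_conj_conj_iff]
    exact hld _ (hconj z hz)
  have hΘ : DifferentiableOn ℂ (fun z => -(l z - l' z) / (2 * Real.pi * I))
      (Metric.ball (-(q:ℂ)) R) := fun z hz =>
    (((hld z hz).sub (hld' z hz)).neg.div_const _).differentiableWithinAt
  have hpi : (Real.pi : ℂ) ≠ 0 := ofReal_ne_zero.2 Real.pi_ne_zero
  have hΘθ : ∀ t : ℝ, |t - q| < R →
      -(l (-(t:ℂ)) - l' (-(t:ℂ))) / (2 * Real.pi * I) = thetaFun α t := fun t _ => by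
    have h1 : l' (-(t:ℂ)) = (starRingEnd ℂ) (l (-(t:ℂ))) := by simp [hl']
    rw [h1, sub_conj, hl, thetaFun, GalphaPlus_eq hα]
    simp only [log_im]
    push_cast
    field_simp
  obtain ⟨M, hM, hpos, hneg⟩ := exists_logStieltjes_eq_of_holomorphic
    (aestronglyMeasurable_thetaFun hα) (fun t ht => thetaFun_mem_Icc hα ht) hR hRq hΘ hΘθ
  have hsub : Metric.ball (-(q:ℂ)) (R / 4) ⊆ Metric.ball (-(q:ℂ)) R :=
    Metric.ball_subset_ball (by linarith)
  refine ⟨R / 4, by positivity, fun z => exp (expRate α * z) * exp ((l z + l' z) / 2 - M z),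
    fun z hz => ?_, fun z hz hz0 => ?_⟩
  · have h1 : DifferentiableAt ℂ M z := (hM z hz).differentiableAt (Metric.isOpen_ball.mem_nhds hz)
    have h2 := hld z (hsub hz)
    have h3 := hld' z (hsub hz)
    exact DifferentiableAt.differentiableWithinAt (by fun_prop)
  · have hz' := hsub hz
    rcases hz0.lt_or_gt with h | h
    · have hG : Galpha α z = exp (l' z) := by
        rw [← conj_conj z, Galpha_conj hα (Or.inr (by simpa using hz0)),
          Galpha_eq_GalphaUp hα (by simpa using hre z hz') (by simpa using h.le),
          ← hexpl _ (hconj z hz'), ← exp_conj]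
        simp [hl']
      rw [GalphaRatio, hG, hneg z hz h, mul_right_comm, mul_comm, ← Complex.exp_add]
      congr 2
      field_simp
      ring
    · rw [GalphaRatio, Galpha_eq_GalphaUp hα (hre z hz') h.le, ← hexpl z hz', hpos z hz h,
        mul_right_comm, mul_comm, ← Complex.exp_add]
      congr 2
      field_simp
      ring

theorem norm_GalphaRatio (α : ℝ) (z : ℂ) :
    ‖GalphaRatio α z‖ = ‖Galpha α z * exp (expRate α * z)‖ *
      Real.exp (-(logStieltjes (thetaFun α) z).re) := by
  rw [GalphaRatio, norm_mul, norm_exp (-_), neg_re]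

theorem differentiableOn_GalphaRatio {α : ℝ} (hα : α ∈ Ioo (0:ℝ) 1) :
    DifferentiableOn ℂ (GalphaRatio α) slitPlane := by
  have h1 := differentiableOn_Galpha hα
  have h2 := differentiableOn_logStieltjes (aestronglyMeasurable_thetaFun hα)
    fun t ht => thetaFun_mem_Icc hα ht
  exact (h1.mul (DifferentiableOn.cexp (by fun_prop))).mul h2.neg.cexp

theorem exists_norm_GalphaRatio_le {α : ℝ} (hα : α ∈ Ioo (0:ℝ) 1) :
    ∃ C, ∀ z : ℂ, z.im ≠ 0 → ‖GalphaRatio α z‖ ≤ C * (1 + ‖z‖) ^ 2 / |z.im| := by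
  obtain ⟨C, hC0, hC⟩ := exists_norm_mul_Galpha_mul_exp_le hα
  refine ⟨C * Real.exp 2 * 2, fun z hz => ?_⟩
  have him : 0 < |z.im| := abs_pos.2 hz
  have hz0 : 0 < ‖z‖ := him.trans_le (abs_im_le_norm z)
  have h1 : ‖Galpha α z * exp (expRate α * z)‖ ≤ C * (‖z‖ + 1) / ‖z‖ := by
    rw [le_div_iff₀ hz0, mul_comm, ← norm_mul, ← mul_assoc]
    exact hC z (Or.inr hz)
  have h2 := exp_neg_re_logStieltjes_mul_le (aestronglyMeasurable_thetaFun hα)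
    (fun t ht => thetaFun_mem_Icc hα ht) hz
  rw [norm_GalphaRatio]
  calc _ ≤ C * (‖z‖ + 1) / ‖z‖ * (Real.exp 2 * (2 * ‖z‖ + 2) * (‖z‖ / |z.im|)) := by gcongr
    _ = _ := by field_simp; ring

theorem norm_GalphaRatio_ofReal_le {α x : ℝ} (hα : α ∈ Ioo (0:ℝ) 1) (hx : 0 < x) :
    ‖GalphaRatio α x‖ ≤
      ‖Galpha α x‖ * Real.exp (expRate α * x) * (Real.exp 2 * (2 * x + 2)) := by
  have h := exp_neg_re_logStieltjes_le (aestronglyMeasurable_thetaFun hα)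
    (fun t ht => thetaFun_mem_Icc hα ht) (z := x) (by simpa using hx)
  rw [norm_real, Real.norm_of_nonneg hx.le] at h
  rw [norm_GalphaRatio, norm_mul, ← ofReal_mul, norm_exp, ofReal_re]
  gcongr

theorem tendsto_mul_GalphaRatio_zero {α : ℝ} (hα : α ∈ Ioo (0:ℝ) 1) :
    Tendsto (fun x : ℝ => (x:ℂ) * GalphaRatio α x) (nhdsWithin 0 (Ioi 0)) (nhds 0) := by
  have h1 : Tendsto (fun x : ℝ => ‖(x:ℂ) * Galpha α x‖ *
      (Real.exp (expRate α * x) * (Real.exp 2 * (2 * x + 2)))) (nhds 0) (nhds 0) := by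
    have h2 : Tendsto (fun x : ℝ => ‖(x:ℂ) * Galpha α x‖) (nhds 0) (nhds 0) := by
      have h3 : Tendsto (fun x : ℝ => (x:ℂ)) (nhds 0) (nhds 0) := by
        simpa using continuous_ofReal.tendsto 0
      simpa using ((tendsto_mul_Galpha_zero hα).comp h3).norm
    have h4 : Continuous fun x : ℝ => Real.exp (expRate α * x) * (Real.exp 2 * (2 * x + 2)) := by
      fun_prop
    simpa using h2.mul (h4.tendsto 0)
  refine squeeze_zero_norm' ?_ (h1.mono_left nhdsWithin_le_nhds)
  filter_upwards [self_mem_nhdsWithin] with x (hx : 0 < x)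
  rw [norm_mul, norm_mul]
  calc _ ≤ ‖(x:ℂ)‖ * (‖Galpha α x‖ * Real.exp (expRate α * x) * (Real.exp 2 * (2 * x + 2))) := by
        gcongr
        exact norm_GalphaRatio_ofReal_le hα hx
    _ = _ := by ring

theorem tendsto_GalphaRatio_div_atTop {α : ℝ} (hα : α ∈ Ioo (0:ℝ) 1) :
    Tendsto (fun x : ℝ => GalphaRatio α x / x) atTop (nhds 0) := by
  have h1 := (tendsto_norm_Galpha_mul_exp hα).mul_const (Real.exp 2 * 4)
  rw [zero_mul] at h1
  refine squeeze_zero_norm' ?_ h1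
  filter_upwards [eventually_ge_atTop 1] with x hx
  have hx0 : 0 < x := by linarith
  rw [norm_div, norm_real, Real.norm_of_nonneg hx0.le, div_le_iff₀ hx0]
  calc _ ≤ ‖Galpha α x‖ * Real.exp (expRate α * x) * (Real.exp 2 * (2 * x + 2)) :=
        norm_GalphaRatio_ofReal_le hα hx0
    _ ≤ ‖Galpha α x‖ * Real.exp (expRate α * x) * (Real.exp 2 * (4 * x)) := by
        gcongr
        linarith
    _ = _ := by ring

theorem exists_GalphaRatio_eq_const {α : ℝ} (hα : α ∈ Ioo (0:ℝ) 1) :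
    ∃ c, ∀ z ∈ slitPlane, GalphaRatio α z = c := by
  obtain ⟨E, hE, hEQ⟩ := exists_differentiableOn_compl_zero_of_local
    (differentiableOn_GalphaRatio hα) fun q hq => exists_GalphaRatio_extension hα hq
  obtain ⟨C, hC⟩ := exists_norm_GalphaRatio_le hα
  have hpos : ∀ x : ℝ, 0 < x → E x = GalphaRatio α x := fun x hx =>
    hEQ (ofReal_mem_slitPlane.2 hx)
  obtain ⟨c, hc⟩ := exists_const_of_punctured hE (C := C)
    (fun z hz => by rw [hEQ (Or.inr hz)]; exact hC z hz)
    ((tendsto_mul_GalphaRatio_zero hα).congr' (by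
      filter_upwards [self_mem_nhdsWithin] with x hx
      rw [hpos x hx]))
    ((tendsto_GalphaRatio_div_atTop hα).congr' (by
      filter_upwards [eventually_gt_atTop 0] with x hx
      rw [hpos x hx]))
  exact ⟨c, fun z hz => by rw [← hEQ hz, hc z (slitPlane_ne_zero hz)]⟩

theorem exists_GalphaRatio_ofReal_eq_pos {α : ℝ} (hα : α ∈ Ioo (0:ℝ) 1) :
    ∃ x a : ℝ, 0 < x ∧ 0 < a ∧ GalphaRatio α x = a := by
  obtain ⟨x, hx, hG⟩ := exists_Galpha_re_pos hα
  have h1 : ((Galpha α x).re : ℂ) = Galpha α x := conj_eq_iff_re.1 (by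
    rw [← Galpha_conj hα (ofReal_mem_slitPlane.2 hx), conj_ofReal])
  have h2 : ((logStieltjes (thetaFun α) x).re : ℂ) = logStieltjes (thetaFun α) x :=
    conj_eq_iff_re.1 (by rw [← logStieltjes_conj, conj_ofReal])
  refine ⟨x, (Galpha α x).re * Real.exp (expRate α * x) *
    Real.exp (-(logStieltjes (thetaFun α) x).re), hx, by positivity, ?_⟩
  push_cast
  rw [GalphaRatio, h1, h2]

/-- Integral representation:
`G_α(z) = a e^{-δ_α z} exp(∫_0^∞ [1/(z+t) - 1/(1+t)] θ_α(t) dt)` for some `a > 0`. -/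
theorem Galpha_integral_representation (α : ℝ) (hα : α ∈ Set.Ioo (0:ℝ) 1) :
    ∃ a : ℝ, 0 < a ∧ ∀ z ∈ Complex.slitPlane,
      MeasureTheory.IntegrableOn
        (fun t : ℝ => (1 / (z + (t:ℂ)) - 1 / (1 + (t:ℂ))) * (thetaFun α t : ℂ)) (Set.Ioi 0) ∧
      Galpha α z = (a:ℂ) * Complex.exp (-(((((1 - α) * α ^ (α / (1 - α)) : ℝ)) : ℂ) * z)) *
        Complex.exp (∫ t in Set.Ioi (0:ℝ),
          (1 / (z + (t:ℂ)) - 1 / (1 + (t:ℂ))) * (thetaFun α t : ℂ)) := by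
  obtain ⟨c, hc⟩ := exists_GalphaRatio_eq_const hα
  obtain ⟨x, a, hx, ha, hxa⟩ := exists_GalphaRatio_ofReal_eq_pos hα
  refine ⟨a, ha, fun z hz => ⟨integrableOn_stieltjes (aestronglyMeasurable_thetaFun hα)
    (fun t ht => thetaFun_mem_Icc hα ht) hz, ?_⟩⟩
  change _ = (a:ℂ) * exp (-((expRate α : ℂ) * z)) * exp (logStieltjes (thetaFun α) z)
  rw [← hxa, hc x (ofReal_mem_slitPlane.2 hx), ← hc z hz, GalphaRatio, Complex.exp_neg,
    Complex.exp_neg]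
  field_simp [Complex.exp_ne_zero]
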